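/- arXiv:1803.08758 — 6 statements merged into one kernel-verified Lean document; each statement's English description precedes it below -/
import Mathlib

section
/- Let (Ω, 𝒜, λ) be a probability space and let (μ^⟦n⟧)_{n≥0} be a cubic coupling on it. Then for every m ≥ 1 and all simplicial sets H₁, H₂ ⊆ {0,1}^m, one has H₁ ⊥_{μ^⟦m⟧} H₂, where μ^⟦m⟧ is viewed as a self-coupling of λ indexed by S = {0,1}^m. -/
open MeasureTheory Set

/-- The meet `ℬ₀ ∧_μ ℬ₁` of two sub-σ-algebras relative to a measure `μ`:
the σ-algebra of all (ambient-)measurable sets `s` admitting `b₀ ∈ ℬ₀` and `b₁ ∈ ℬ₁`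
with `μ (s ∆ b₀) = μ (s ∆ b₁) = 0`. -/
def meetAlg {α : Type*} {mα : MeasurableSpace α} (μ : Measure α)
    (B0 B1 : MeasurableSpace α) : MeasurableSpace α where
  MeasurableSet' s := MeasurableSet[mα] s ∧
    (∃ b0, MeasurableSet[B0] b0 ∧ μ (symmDiff s b0) = 0) ∧
    (∃ b1, MeasurableSet[B1] b1 ∧ μ (symmDiff s b1) = 0)
  measurableSet_empty :=
    ⟨@MeasurableSet.empty _ mα, ⟨∅, @MeasurableSet.empty _ B0, by simp⟩,
      ⟨∅, @MeasurableSet.empty _ B1, by simp⟩⟩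
  measurableSet_compl := by
    rintro s ⟨hs, ⟨b0, hb0, h0⟩, ⟨b1, hb1, h1⟩⟩
    exact ⟨hs.compl, ⟨b0ᶜ, hb0.compl, by rwa [compl_symmDiff_compl]⟩,
      ⟨b1ᶜ, hb1.compl, by rwa [compl_symmDiff_compl]⟩⟩
  measurableSet_iUnion := by
    intro f hf
    have key : ∀ (s b : ℕ → Set α),
        symmDiff (⋃ i, s i) (⋃ i, b i) ⊆ ⋃ i, symmDiff (s i) (b i) := by
      intro s b x hx
      rw [Set.mem_symmDiff] at hx
      rcases hx with ⟨hx1, hx2⟩ | ⟨hx1, hx2⟩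
      · obtain ⟨i, hi⟩ := Set.mem_iUnion.1 hx1
        exact Set.mem_iUnion.2 ⟨i, Set.mem_symmDiff.2
          (Or.inl ⟨hi, fun h => hx2 (Set.mem_iUnion.2 ⟨i, h⟩)⟩)⟩
      · obtain ⟨i, hi⟩ := Set.mem_iUnion.1 hx1
        exact Set.mem_iUnion.2 ⟨i, Set.mem_symmDiff.2
          (Or.inr ⟨hi, fun h => hx2 (Set.mem_iUnion.2 ⟨i, h⟩)⟩)⟩
    choose hmeas h0 h1 using hf
    choose b0 hb0 hb0' using h0
    choose b1 hb1 hb1' using h1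
    exact ⟨MeasurableSet.iUnion hmeas,
      ⟨⋃ i, b0 i, MeasurableSet.iUnion hb0,
        measure_mono_null (key f b0) (measure_iUnion_null hb0')⟩,
      ⟨⋃ i, b1 i, MeasurableSet.iUnion hb1,
        measure_mono_null (key f b1) (measure_iUnion_null hb1')⟩⟩

/-- Conditional independence of the sub-σ-algebras `B0` and `B1` relative to `B`,
with respect to the measure `μ`: `E(f₀ f₁ | B) = E(f₀ | B) ⬝ E(f₁ | B)` a.e. for all
bounded `B0`- resp. `B1`-measurable real functions. -/
def CondIndepRel {α : Type*} {mα : MeasurableSpace α} (μ : Measure α)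
    (B0 B1 B : MeasurableSpace α) : Prop :=
  ∀ f0 f1 : α → ℝ, Measurable[B0] f0 → Measurable[B1] f1 →
    (∃ C, ∀ x, |f0 x| ≤ C) → (∃ C, ∀ x, |f1 x| ≤ C) →
    μ[fun x => f0 x * f1 x|B] =ᵐ[μ] fun x => (μ[f0|B]) x * (μ[f1|B]) x

/-- Two σ-algebras agree up to `μ`-null sets: every set of either one differs from a set
of the other by a `μ`-null set. -/
def EqModNull {α : Type*} {mα : MeasurableSpace α} (μ : Measure α)
    (B0 B1 : MeasurableSpace α) : Prop :=
  (∀ s, MeasurableSet[B0] s → ∃ t, MeasurableSet[B1] t ∧ μ (symmDiff s t) = 0) ∧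
  (∀ s, MeasurableSet[B1] s → ∃ t, MeasurableSet[B0] t ∧ μ (symmDiff s t) = 0)

/-- The sub-σ-algebra `𝒜^S_T` of the product σ-algebra on `ι → Ω`:
preimages under the projection to coordinates in `T` of product-measurable sets. -/
def cylinderAlg {Ω : Type*} (ι : Type*) [MeasurableSpace Ω] (T : Set ι) :
    MeasurableSpace (ι → Ω) :=
  MeasurableSpace.comap (fun ω => T.restrict ω) MeasurableSpace.pi

/-- The relation `T₁ ⊥_μ T₂` for index sets of a self-coupling: the coordinate
σ-algebras `𝒜^S_{T₁}` and `𝒜^S_{T₂}` are conditionally independent relative to their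
meet, and moreover this meet agrees with `𝒜^S_{T₁ ∩ T₂}` up to `μ`-null sets. -/
def BotRel {Ω ι : Type*} [MeasurableSpace Ω] (μ : Measure (ι → Ω)) (T1 T2 : Set ι) : Prop :=
  CondIndepRel μ (cylinderAlg ι T1) (cylinderAlg ι T2)
      (meetAlg μ (cylinderAlg ι T1) (cylinderAlg ι T2)) ∧
  EqModNull μ (meetAlg μ (cylinderAlg ι T1) (cylinderAlg ι T2)) (cylinderAlg ι (T1 ∩ T2))

/-- A cube morphism `{0,1}^m → {0,1}^n`: each coordinate function is constant, a
coordinate of the argument, or the negation of a coordinate of the argument (i.e. the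
map extends to an affine homomorphism `ℤ^m → ℤ^n`). -/
def IsCubeMorphism {m n : ℕ} (φ : (Fin m → Bool) → (Fin n → Bool)) : Prop :=
  ∀ j : Fin n, (∃ c, ∀ v, φ v j = c) ∨
    ∃ i : Fin m, (∀ v, φ v j = v i) ∨ (∀ v, φ v j = !(v i))

/-- A cubic coupling on a probability space `(Ω, 𝒜, lam)`: a sequence of self-couplings
`μ n` of `lam` indexed by the discrete cubes `{0,1}^n`, satisfying the consistency,
ergodicity and conditional independence axioms. -/
structure IsCubicCoupling {Ω : Type*} [MeasurableSpace Ω] (lam : Measure Ω)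
    (μ : (n : ℕ) → Measure ((Fin n → Bool) → Ω)) : Prop where
  coupling : ∀ (n : ℕ) (v : Fin n → Bool), (μ n).map (fun ω => ω v) = lam
  consistency : ∀ {m n : ℕ} (φ : (Fin m → Bool) → (Fin n → Bool)),
    IsCubeMorphism φ → Function.Injective φ →
    (μ n).map (fun ω => ω ∘ φ) = μ m
  ergodicity : μ 1 = Measure.pi fun _ : Fin 1 → Bool => lam
  condIndep : ∀ n : ℕ,
    BotRel (μ (n + 1)) {v : Fin (n + 1) → Bool | v 0 = false}
      {v : Fin (n + 1) → Bool | v (Fin.last n) = false}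

/-- A set `H ⊆ {0,1}^m` is simplicial if it is downward closed with respect to the
coordinatewise order (support inclusion). -/
def IsSimplicial {m : ℕ} (H : Set (Fin m → Bool)) : Prop :=
  ∀ v ∈ H, ∀ w : Fin m → Bool, (∀ i, w i = true → v i = true) → w ∈ H

namespace CubicAux

/-- Bounded measurable functions on `ι → Ω` depending only on the coordinates in `T`. -/
structure BM {Ω ι : Type*} [MeasurableSpace Ω] (T : Set ι) (f : (ι → Ω) → ℝ) : Prop where
  meas : Measurable f
  bdd : ∃ C, ∀ x, |f x| ≤ C
  dep : ∀ x y, (∀ v ∈ T, x v = y v) → f x = f y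

section general

variable {Ω ι : Type*} [MeasurableSpace Ω]

theorem BM.mono {T T' : Set ι} {f : (ι → Ω) → ℝ} (h : BM T f) (hT : T ⊆ T') : BM T' f :=
  ⟨h.meas, h.bdd, fun x y hxy => h.dep x y fun v hv => hxy v (hT hv)⟩

theorem BM.mul {T : Set ι} {f g : (ι → Ω) → ℝ} (hf : BM T f) (hg : BM T g) :
    BM T (fun x => f x * g x) := by
  refine ⟨hf.meas.mul hg.meas, ?_, fun x y h => by rw [hf.dep x y h, hg.dep x y h]⟩
  obtain ⟨C, hC⟩ := hf.bdd
  obtain ⟨D, hD⟩ := hg.bdd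
  exact ⟨C * D, fun x => by
    rw [abs_mul]
    exact mul_le_mul (hC x) (hD x) (abs_nonneg _) ((abs_nonneg _).trans (hC x))⟩

theorem BM.sub {T : Set ι} {f g : (ι → Ω) → ℝ} (hf : BM T f) (hg : BM T g) :
    BM T (fun x => f x - g x) := by
  refine ⟨hf.meas.sub hg.meas, ?_, fun x y h => by rw [hf.dep x y h, hg.dep x y h]⟩
  obtain ⟨C, hC⟩ := hf.bdd
  obtain ⟨D, hD⟩ := hg.bdd
  exact ⟨C + D, fun x => (abs_sub _ _).trans (add_le_add (hC x) (hD x))⟩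

theorem BM.const (T : Set ι) (c : ℝ) : BM T (fun _ : ι → Ω => c) :=
  ⟨measurable_const, ⟨|c|, fun _ => le_rfl⟩, fun _ _ _ => rfl⟩

theorem BM.prod {κ : Type*} {T : Set ι} (s : Finset κ) {f : κ → (ι → Ω) → ℝ}
    (hf : ∀ k ∈ s, BM T (f k)) : BM T (fun x => ∏ k ∈ s, f k x) := by
  classical
  induction s using Finset.induction_on with
  | empty => simpa using BM.const T 1
  | insert a s ha ih =>
    simp only [Finset.prod_insert ha]
    exact (hf a (by simp)).mul (ih fun k hk => hf k (by simp [hk]))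

theorem BM.eval {T : Set ι} {v : ι} (hv : v ∈ T) {f : Ω → ℝ} (hf : Measurable f)
    (hb : ∃ C, ∀ x, |f x| ≤ C) : BM T (fun x => f (x v)) := by
  refine ⟨hf.comp (measurable_pi_apply v), ?_, fun x y h => by rw [h v hv]⟩
  obtain ⟨C, hC⟩ := hb
  exact ⟨C, fun x => hC _⟩

theorem measurable_precomp {κ : Type*} (φ : κ → ι) :
    Measurable (fun x : ι → Ω => x ∘ φ) :=
  measurable_pi_lambda _ fun k => measurable_pi_apply (φ k)

theorem BM.comp {κ : Type*} {T : Set κ} {f : (κ → Ω) → ℝ} (hf : BM T f) (φ : κ → ι)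
    {T' : Set ι} (h : ∀ v ∈ T, φ v ∈ T') : BM T' (fun x => f (x ∘ φ)) := by
  refine ⟨hf.meas.comp (measurable_precomp φ), ?_, fun x y hxy => hf.dep _ _ fun v hv => ?_⟩
  · obtain ⟨C, hC⟩ := hf.bdd
    exact ⟨C, fun x => hC _⟩
  · exact hxy _ (h v hv)

theorem BM.integrable {T : Set ι} {f : (ι → Ω) → ℝ} (hf : BM T f)
    (μ : Measure (ι → Ω)) [IsProbabilityMeasure μ] : Integrable f μ := by
  obtain ⟨C, hC⟩ := hf.bdd
  exact Integrable.of_bound hf.meas.aestronglyMeasurable C (Filter.Eventually.of_forall hC)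

theorem cyl_le (T : Set ι) :
    cylinderAlg (Ω := Ω) ι T ≤ MeasurableSpace.pi := by
  refine Measurable.comap_le ?_
  exact measurable_pi_lambda _ fun k => measurable_pi_apply _

theorem cyl_dep {T : Set ι} {f : (ι → Ω) → ℝ} (hf : Measurable[cylinderAlg ι T] f)
    (x y : ι → Ω) (h : ∀ v ∈ T, x v = y v) : f x = f y := by
  have := hf (measurableSet_singleton (f y))
  obtain ⟨t, _, ht⟩ := this
  have hy : y ∈ f ⁻¹' {f y} := rfl
  have hx : x ∈ f ⁻¹' {f y} := by
    rw [← ht] at hy ⊢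
    have : T.restrict x = T.restrict y := by
      ext v; exact h v v.2
    simpa [this] using hy
  exact hx

theorem cyl_BM {T : Set ι} {f : (ι → Ω) → ℝ} (hf : Measurable[cylinderAlg ι T] f)
    (hb : ∃ C, ∀ x, |f x| ≤ C) : BM T f :=
  ⟨hf.mono (cyl_le T) le_rfl, hb, cyl_dep hf⟩

theorem BM.cyl [Nonempty Ω] {T : Set ι} {f : (ι → Ω) → ℝ} (hf : BM T f) :
    Measurable[cylinderAlg ι T] f := by
  classical
  let e : (T → Ω) → (ι → Ω) := fun y v => if h : v ∈ T then y ⟨v, h⟩ else Classical.arbitrary Ω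
  have he : Measurable e := by
    refine measurable_pi_lambda _ fun v => ?_
    by_cases h : v ∈ T
    · simp only [e, h, dite_true]; exact measurable_pi_apply _
    · simp only [e, h, dite_false]; exact measurable_const
  have : f = (f ∘ e) ∘ (fun ω => T.restrict ω) := by
    ext x
    refine hf.dep _ _ fun v hv => ?_
    simp only [e, hv, dite_true]; rfl
  rw [this]
  exact (hf.meas.comp he).comp (comap_measurable _)

theorem BM.smeas [Nonempty Ω] {T : Set ι} {f : (ι → Ω) → ℝ} (hf : BM T f) :
    StronglyMeasurable[cylinderAlg ι T] f :=
  hf.cyl.stronglyMeasurable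

/-- pull-out formula under the integral. -/
theorem integral_condExp_mul {μ : Measure (ι → Ω)} [IsProbabilityMeasure μ]
    {m : MeasurableSpace (ι → Ω)} (hm : m ≤ MeasurableSpace.pi) {f g : (ι → Ω) → ℝ}
    (hf : BM univ f) (hg : BM univ g) (hgm : StronglyMeasurable[m] g) :
    ∫ x, f x * g x ∂μ = ∫ x, (μ[f|m]) x * g x ∂μ := by
  have h1 : μ[f * g|m] =ᵐ[μ] μ[f|m] * g :=
    condExp_mul_of_stronglyMeasurable_right hgm ((hf.mul hg).integrable μ) (hf.integrable μ)
  calc ∫ x, f x * g x ∂μ = ∫ x, (μ[f * g|m]) x ∂μ := (integral_condExp hm).symm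
    _ = ∫ x, (μ[f|m]) x * g x ∂μ := integral_congr_ae h1

theorem exists_trunc {μ : Measure (ι → Ω)} [IsProbabilityMeasure μ]
    {m : MeasurableSpace (ι → Ω)} {f : (ι → Ω) → ℝ}
    (hb : ∃ C, ∀ x, |f x| ≤ C) :
    ∃ h : (ι → Ω) → ℝ, Measurable[m] h ∧ (∃ C, ∀ x, |h x| ≤ C) ∧ h =ᵐ[μ] μ[f|m] := by
  obtain ⟨C, hC⟩ := hb
  have hC0 : 0 ≤ |C| := abs_nonneg C
  have hbd : ∀ᵐ x ∂μ, |(μ[f|m]) x| ≤ |C| :=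
    ae_bdd_abs_condExp_of_ae_bdd_abs (Filter.Eventually.of_forall fun x => (hC x).trans (le_abs_self C))
  have hms : Measurable[m] (μ[f|m]) := stronglyMeasurable_condExp.measurable
  refine ⟨fun x => max (-|C|) (min |C| ((μ[f|m]) x)), ?_, ⟨|C|, fun x => ?_⟩, ?_⟩
  · exact Measurable.max measurable_const (Measurable.min measurable_const hms)
  · rw [abs_le]
    exact ⟨le_max_left _ _, max_le (by linarith) (min_le_left _ _)⟩
  · filter_upwards [hbd] with x hx
    have hx' := abs_le.1 hx
    rw [min_eq_right hx'.2, max_eq_right hx'.1]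

theorem exists_ce [Nonempty Ω] (μ : Measure (ι → Ω)) [IsProbabilityMeasure μ] (T : Set ι)
    {f : (ι → Ω) → ℝ} (hf : BM univ f) :
    ∃ h, BM T h ∧ h =ᵐ[μ] μ[f|cylinderAlg ι T] ∧
      ∀ g, BM T g → ∫ x, f x * g x ∂μ = ∫ x, h x * g x ∂μ := by
  obtain ⟨h, h1, h2, h3⟩ := exists_trunc (μ := μ) (m := cylinderAlg ι T) hf.bdd
  refine ⟨h, cyl_BM h1 h2, h3, fun g hg => ?_⟩
  rw [integral_condExp_mul (cyl_le T) hf (hg.mono (subset_univ _)) hg.smeas]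
  exact integral_congr_ae (by filter_upwards [h3] with x hx; rw [hx])

theorem ae_eq_of_sq {μ : Measure (ι → Ω)} [IsProbabilityMeasure μ] {f g : (ι → Ω) → ℝ}
    (hf : BM univ f) (hg : BM univ g)
    (h : ∫ x, f x * f x ∂μ - 2 * ∫ x, f x * g x ∂μ + ∫ x, g x * g x ∂μ = 0) :
    f =ᵐ[μ] g := by
  have h1 : ∫ x, (f x - g x) * (f x - g x) ∂μ = 0 := by
    rw [← h, ← integral_const_mul, ← integral_sub ((hf.mul hf).integrable μ)
      (((hf.mul hg).integrable μ).const_mul 2), ← integral_add _ ((hg.mul hg).integrable μ)]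
    · congr 1; ext x; ring
    · exact ((hf.mul hf).integrable μ).sub (((hf.mul hg).integrable μ).const_mul 2)
  rw [integral_eq_zero_iff_of_nonneg (fun x => mul_self_nonneg _)
    (((hf.sub hg).mul (hf.sub hg)).integrable μ)] at h1
  filter_upwards [h1] with x hx
  have : f x - g x = 0 := by simpa using hx
  linarith

theorem ae_eq_of_test {μ : Measure (ι → Ω)} [IsProbabilityMeasure μ] {T : Set ι}
    {f g : (ι → Ω) → ℝ} (hf : BM T f) (hg : BM T g)
    (h : ∀ k, BM T k → ∫ x, f x * k x ∂μ = ∫ x, g x * k x ∂μ) : f =ᵐ[μ] g := by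
  refine ae_eq_of_sq (hf.mono (subset_univ _)) (hg.mono (subset_univ _)) ?_
  rw [h f hf, ← h g hg]
  have : ∫ x, g x * f x ∂μ = ∫ x, f x * g x ∂μ := by congr 1; ext x; ring
  rw [this]; ring

theorem box [Fintype ι] [Nonempty Ω] {μ : Measure (ι → Ω)} [IsProbabilityMeasure μ] {T : Set ι}
    {F F' : (ι → Ω) → ℝ} (hF : BM univ F) (hF' : BM univ F')
    (h : ∀ G : ι → Ω → ℝ, (∀ v, Measurable (G v)) → (∀ v, ∃ C, ∀ y, |G v y| ≤ C) →
      (∀ v, v ∉ T → G v = fun _ => 1) →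
      ∫ x, F x * ∏ v, G v (x v) ∂μ = ∫ x, F' x * ∏ v, G v (x v) ∂μ)
    (g : (ι → Ω) → ℝ) (hg : BM T g) :
    ∫ x, F x * g x ∂μ = ∫ x, F' x * g x ∂μ := by
  classical
  set D : (ι → Ω) → ℝ := fun x => F x - F' x with hD
  have hDb : BM univ D := hF.sub hF'
  have hsub : ∀ g, BM univ g →
      ∫ x, D x * g x ∂μ = ∫ x, F x * g x ∂μ - ∫ x, F' x * g x ∂μ := by
    intro g hg
    rw [← integral_sub ((hF.mul hg).integrable μ) ((hF'.mul hg).integrable μ)]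
    congr 1; ext x; simp only [hD]; ring
  have hres : Measurable (fun ω : ι → Ω => T.restrict ω) :=
    measurable_pi_lambda _ fun k => measurable_pi_apply _
  have hbox : ∀ t : T → Set Ω, (∀ v, MeasurableSet (t v)) →
      ∫ x in (fun ω : ι → Ω => T.restrict ω) ⁻¹' (pi univ t), D x ∂μ = 0 := by
    intro t ht
    let G : ι → Ω → ℝ := fun v => if hv : v ∈ T then (t ⟨v, hv⟩).indicator (fun _ => 1)
      else fun _ => 1
    have hGm : ∀ v, Measurable (G v) := by
      intro v
      by_cases hv : v ∈ T
      · simp only [G, hv, dite_true]; exact measurable_const.indicator (ht _)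
      · simp only [G, hv, dite_false]; exact measurable_const
    have hGb : ∀ v, ∃ C, ∀ y, |G v y| ≤ C := by
      intro v
      refine ⟨1, fun y => ?_⟩
      by_cases hv : v ∈ T
      · simp only [G, hv, dite_true, indicator]
        split_ifs <;> simp
      · simp [G, hv]
    have hprod : BM univ (fun x : ι → Ω => ∏ v, G v (x v)) :=
      BM.prod _ fun v _ => BM.eval (mem_univ v) (hGm v) (hGb v)
    have e := h G hGm hGb (fun v hv => by simp [G, hv])
    rw [← sub_eq_zero, ← hsub _ hprod] at e
    rw [← integral_indicator (hres (MeasurableSet.univ_pi ht)), ← e]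
    congr 1; ext x
    by_cases hx : x ∈ (fun ω : ι → Ω => T.restrict ω) ⁻¹' (pi univ t)
    · rw [indicator_of_mem hx, Finset.prod_eq_one, mul_one]
      intro v _
      by_cases hv : v ∈ T
      · have : x v ∈ t ⟨v, hv⟩ := hx ⟨v, hv⟩ (mem_univ _)
        simp [G, hv, this]
      · simp [G, hv]
    · rw [indicator_of_notMem hx]
      have : ∃ v : T, x v ∉ t v := by
        by_contra hc
        push Not at hc
        exact hx fun v _ => hc v
      obtain ⟨v, hv⟩ := this
      rw [Finset.prod_eq_zero (Finset.mem_univ (v : ι)), mul_zero]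
      simp [G, hv]
  have htot : ∫ x, D x ∂μ = 0 := by
    have := hbox (fun _ => univ) (fun _ => MeasurableSet.univ)
    simpa [pi_univ] using this
  have hall : ∀ S : Set (T → Ω), MeasurableSet S →
      ∫ x in (fun ω : ι → Ω => T.restrict ω) ⁻¹' S, D x ∂μ = 0 := by
    intro S hS
    induction S, hS using MeasurableSpace.induction_on_inter
      (generateFrom_pi (α := fun _ : T => Ω)).symm isPiSystem_pi with
    | empty => simp
    | basic S hS =>
      obtain ⟨t, ht, rfl⟩ := hS
      exact hbox t fun v => ht v (mem_univ _)
    | compl S hS ih =>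
      rw [preimage_compl]
      have := integral_add_compl (hres hS) (hDb.integrable μ)
      linarith
    | iUnion f hd hm ih =>
      rw [preimage_iUnion]
      rw [integral_iUnion (fun i => hres (hm i))
        (fun i j hij => (hd hij).preimage _) (hDb.integrable μ).integrableOn]
      simp [ih]
  have hce : (0 : (ι → Ω) → ℝ) =ᵐ[μ] μ[D|cylinderAlg ι T] := by
    refine ae_eq_condExp_of_forall_setIntegral_eq (cyl_le T) (hDb.integrable μ)
      (fun s _ _ => integrableOn_zero) ?_ aestronglyMeasurable_zero
    rintro s ⟨S, hS, rfl⟩ _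
    rw [hall S hS]; simp
  have h1 := integral_condExp_mul (μ := μ) (cyl_le T) hDb (hg.mono (subset_univ _)) hg.smeas
  rw [hsub g (hg.mono (subset_univ _))] at h1
  have h2 : ∫ x, (μ[D|cylinderAlg ι T]) x * g x ∂μ = 0 := by
    rw [← integral_zero (ι → Ω) ℝ (μ := μ)]
    exact integral_congr_ae (by filter_upwards [hce] with x hx; rw [← hx]; simp)
  linarith

theorem cyl_mono {T T' : Set ι} (h : T ⊆ T') :
    cylinderAlg (Ω := Ω) ι T ≤ cylinderAlg ι T' := by
  rintro s ⟨S, hS, rfl⟩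
  refine ⟨(fun y : T' → Ω => fun v : T => y ⟨v, h v.2⟩) ⁻¹' S, ?_, rfl⟩
  exact (measurable_pi_lambda _ fun v => measurable_pi_apply _) hS

theorem meet_le {μ : Measure (ι → Ω)} {T1 T2 : Set ι} :
    meetAlg μ (cylinderAlg ι T1) (cylinderAlg ι T2) ≤ MeasurableSpace.pi :=
  fun _ hs => hs.1

theorem cyl_le_meet {μ : Measure (ι → Ω)} {T1 T2 : Set ι} :
    cylinderAlg ι (T1 ∩ T2) ≤ meetAlg μ (cylinderAlg ι T1) (cylinderAlg ι T2) :=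
  fun s hs => ⟨cyl_le _ s hs, ⟨s, cyl_mono inter_subset_left s hs, by simp⟩,
    ⟨s, cyl_mono inter_subset_right s hs, by simp⟩⟩

theorem meet_condExp {μ : Measure (ι → Ω)} [IsProbabilityMeasure μ] {T1 T2 : Set ι}
    (h : ∀ s, MeasurableSet[meetAlg μ (cylinderAlg ι T1) (cylinderAlg ι T2)] s →
      ∃ t, MeasurableSet[cylinderAlg ι (T1 ∩ T2)] t ∧ μ (symmDiff s t) = 0)
    {f : (ι → Ω) → ℝ} (hf : BM univ f) :
    μ[f|cylinderAlg ι (T1 ∩ T2)] =ᵐ[μ]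
      μ[f|meetAlg μ (cylinderAlg ι T1) (cylinderAlg ι T2)] := by
  refine ae_eq_condExp_of_forall_setIntegral_eq meet_le (hf.integrable μ)
    (fun s _ _ => integrable_condExp.integrableOn) ?_
    (stronglyMeasurable_condExp.mono cyl_le_meet).aestronglyMeasurable
  intro s hs _
  obtain ⟨t, ht, hst⟩ := h s hs
  have e : s =ᵐ[μ] t := measure_symmDiff_eq_zero_iff.1 hst
  rw [setIntegral_congr_set e, setIntegral_congr_set e,
    setIntegral_condExp (cyl_le _) (hf.integrable μ) ht]

/-- test-function form of `BotRel`, from `BotRel`. -/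
theorem botRel_test [Nonempty Ω] {μ : Measure (ι → Ω)} [IsProbabilityMeasure μ] {T1 T2 : Set ι}
    (h : BotRel μ T1 T2) {f : (ι → Ω) → ℝ} (hf : BM T1 f) :
    ∃ k, BM (T1 ∩ T2) k ∧ ∀ g, BM T2 g → ∫ x, f x * g x ∂μ = ∫ x, k x * g x ∂μ := by
  obtain ⟨hci, heq, _⟩ := h
  have hfu := hf.mono (subset_univ _)
  obtain ⟨k, hk, hke, -⟩ := exists_ce μ (T1 ∩ T2) hfu
  refine ⟨k, hk, fun g hg => ?_⟩
  have hgu := hg.mono (subset_univ _)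
  set M := meetAlg μ (cylinderAlg ι T1) (cylinderAlg ι T2) with hM
  have e1 := hci f g hf.cyl hg.cyl hf.bdd hg.bdd
  have e2 : k =ᵐ[μ] μ[f|M] := hke.trans (meet_condExp heq hfu)
  have hkM : StronglyMeasurable[M] k := hk.smeas.mono cyl_le_meet
  calc ∫ x, f x * g x ∂μ = ∫ x, (μ[fun x => f x * g x|M]) x ∂μ :=
        (integral_condExp meet_le).symm
    _ = ∫ x, (μ[g|M]) x * k x ∂μ := by
        refine integral_congr_ae ?_
        filter_upwards [e1, e2] with x h1 h2
        rw [h1, h2, mul_comm]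
    _ = ∫ x, g x * k x ∂μ :=
        (integral_condExp_mul meet_le hgu (hk.mono (subset_univ _)) hkM).symm
    _ = ∫ x, k x * g x ∂μ := by congr 1; ext x; ring

/-- `BotRel` from its test-function form. -/
theorem botRel_of_test [Nonempty Ω] {μ : Measure (ι → Ω)} [IsProbabilityMeasure μ]
    {T1 T2 : Set ι}
    (h : ∀ f, BM T1 f → ∃ k, BM (T1 ∩ T2) k ∧
      ∀ g, BM T2 g → ∫ x, f x * g x ∂μ = ∫ x, k x * g x ∂μ) : BotRel μ T1 T2 := by
  have heq : ∀ s, MeasurableSet[meetAlg μ (cylinderAlg ι T1) (cylinderAlg ι T2)] s →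
      ∃ t, MeasurableSet[cylinderAlg ι (T1 ∩ T2)] t ∧ μ (symmDiff s t) = 0 := by
    rintro s ⟨hs, ⟨b0, hb0, h0⟩, ⟨b1, hb1, h1⟩⟩
    have ind : ∀ (T : Set ι) (b : Set (ι → Ω)), MeasurableSet[cylinderAlg ι T] b →
        BM T (b.indicator fun _ => (1 : ℝ)) := by
      intro T b hb
      refine cyl_BM (Measurable.indicator measurable_const hb) ⟨1, fun x => ?_⟩
      by_cases hx : x ∈ b <;> simp [hx]
    obtain ⟨k, hk, hk'⟩ := h _ (ind T1 b0 hb0)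
    have e0 : s =ᵐ[μ] b0 := measure_symmDiff_eq_zero_iff.1 h0
    have e1 : s =ᵐ[μ] b1 := measure_symmDiff_eq_zero_iff.1 h1
    have e01 : b0.indicator (fun _ => (1 : ℝ)) =ᵐ[μ] b1.indicator (fun _ => (1 : ℝ)) :=
      indicator_ae_eq_of_ae_eq_set (e0.symm.trans e1)
    have hke : b1.indicator (fun _ => (1 : ℝ)) =ᵐ[μ] k := by
      refine ae_eq_of_test (ind T2 b1 hb1) (hk.mono inter_subset_right) fun g hg => ?_
      rw [← hk' g hg]
      exact integral_congr_ae (by filter_upwards [e01] with x hx; rw [hx])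
    refine ⟨k ⁻¹' {1}, hk.cyl (measurableSet_singleton 1), ?_⟩
    rw [measure_symmDiff_eq_zero_iff]
    filter_upwards [e1, hke] with x hx1 hx2
    refine hx1.trans ?_
    change (x ∈ b1) = (k x = 1)
    rw [← hx2]
    by_cases hx : x ∈ b1 <;> simp [hx]
  refine ⟨?_, heq, fun s hs => ⟨s, cyl_le_meet s hs, by simp⟩⟩
  intro f g hf hg hfb hgb
  have hF := cyl_BM hf hfb
  have hG := cyl_BM hg hgb
  have hFu := hF.mono (subset_univ _)
  have hGu := hG.mono (subset_univ _)
  set A := cylinderAlg (Ω := Ω) ι (T1 ∩ T2) with hA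
  refine (meet_condExp heq (hFu.mul hGu)).symm.trans ?_
  have e1 := meet_condExp heq hFu
  have e2 := meet_condExp heq hGu
  obtain ⟨k, hk, hk'⟩ := h f hF
  obtain ⟨l, hl, hle, hl'⟩ := exists_ce μ (T1 ∩ T2) hGu
  obtain ⟨k2, hk2, hke, hk2'⟩ := exists_ce μ (T1 ∩ T2) hFu
  obtain ⟨p, hp, hpe, hp'⟩ := exists_ce μ (T1 ∩ T2) (hFu.mul hGu)
  have ek : k =ᵐ[μ] k2 := ae_eq_of_test hk hk2 fun g hg => by
    rw [← hk' g (hg.mono inter_subset_right), ← hk2' g hg]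
  have ep : p =ᵐ[μ] fun x => k x * l x := by
    refine ae_eq_of_test hp (hk.mul hl) fun q hq => ?_
    rw [← hp' q hq]
    calc ∫ x, f x * g x * q x ∂μ = ∫ x, f x * (g x * q x) ∂μ := by congr 1; ext x; ring
      _ = ∫ x, k x * (g x * q x) ∂μ := hk' _ (hG.mul (hq.mono inter_subset_right))
      _ = ∫ x, g x * (k x * q x) ∂μ := by congr 1; ext x; ring
      _ = ∫ x, l x * (k x * q x) ∂μ := hl' _ (hk.mul hq)
      _ = ∫ x, k x * l x * q x ∂μ := by congr 1; ext x; ring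
  filter_upwards [e1, e2, hpe, ep, ek, hle, hke] with x h1 h2 h3 h4 h5 h6 h7
  rw [← h3, h4, ← h1, ← h2, h5, h6, h7]

end general

set_option linter.unusedSectionVars false

section cubes

/-- Insert the value `t` in coordinate `i`. -/
def ins {n : ℕ} (i : Fin (n + 1)) (t : Bool) (v : Fin n → Bool) : Fin (n + 1) → Bool :=
  Fin.insertNth (α := fun _ => Bool) i t v

theorem ins_same {n : ℕ} (i : Fin (n + 1)) (t : Bool) (v : Fin n → Bool) : ins i t v i = t := by
  simp [ins]

theorem ins_above {n : ℕ} (i : Fin (n + 1)) (t : Bool) (v : Fin n → Bool) (j : Fin n) :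
    ins i t v (i.succAbove j) = v j := by
  simp [ins]

theorem ins_eta {n : ℕ} (i : Fin (n + 1)) (t : Bool) (w : Fin (n + 1) → Bool) (h : w i = t) :
    ins i t (fun j => w (i.succAbove j)) = w := by
  funext j
  revert j
  rw [Fin.forall_iff_succAbove i]
  exact ⟨by rw [ins_same, h], fun j => by rw [ins_above]⟩

theorem bool_fun (A : Bool → Bool) :
    (∃ c, ∀ b, A b = c) ∨ (∀ b, A b = b) ∨ (∀ b, A b = !b) := by
  rcases h0 : A false <;> rcases h1 : A true
  · exact Or.inl ⟨false, fun b => by cases b <;> assumption⟩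
  · exact Or.inr (Or.inl fun b => by cases b <;> assumption)
  · exact Or.inr (Or.inr fun b => by cases b <;> assumption)
  · exact Or.inl ⟨true, fun b => by cases b <;> assumption⟩

theorem morph_coord {m : ℕ} (A : Bool → Bool) (i : Fin m) :
    (∃ c, ∀ v : Fin m → Bool, A (v i) = c) ∨
    ∃ i' : Fin m, (∀ v : Fin m → Bool, A (v i) = v i') ∨ (∀ v : Fin m → Bool, A (v i) = !(v i')) := by
  rcases bool_fun A with ⟨c, h⟩ | h | h
  · exact Or.inl ⟨c, fun v => h _⟩
  · exact Or.inr ⟨i, Or.inl fun v => h _⟩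
  · exact Or.inr ⟨i, Or.inr fun v => h _⟩

/-- The corner `(a, ·, b)` of the `n+2`-cube. -/
def cor {n : ℕ} (a b : Bool) (v : Fin n → Bool) : Fin (n + 2) → Bool :=
  ins 0 a (ins (Fin.last n) b v)

/-- The cube morphism `(t, v) ↦ (A t, v, B t)`. -/
def two {n : ℕ} (A B : Bool → Bool) (w : Fin (n + 1) → Bool) : Fin (n + 2) → Bool :=
  cor (A (w 0)) (B (w 0)) fun j => w (Fin.succAbove 0 j)

theorem cor_zero {n : ℕ} (a b : Bool) (v : Fin n → Bool) : cor a b v 0 = a := ins_same _ _ _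

theorem cor_last {n : ℕ} (a b : Bool) (v : Fin n → Bool) : cor a b v (Fin.last (n + 1)) = b := by
  have : Fin.last (n + 1) = Fin.succAbove 0 (Fin.last n) := by simp
  rw [this, cor, ins_above, ins_same]

theorem cor_mid {n : ℕ} (a b : Bool) (v : Fin n → Bool) (j : Fin n) :
    cor a b v (Fin.succAbove 0 ((Fin.last n).succAbove j)) = v j := by
  rw [cor, ins_above, ins_above]

theorem cor_eta {n : ℕ} (a b : Bool) (w : Fin (n + 2) → Bool) (h0 : w 0 = a)
    (h1 : w (Fin.last (n + 1)) = b) :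
    cor a b (fun j => w (Fin.succAbove 0 ((Fin.last n).succAbove j))) = w := by
  rw [cor]
  have := ins_eta (Fin.last n) b (fun j => w (Fin.succAbove 0 j)) (by simpa using h1)
  rw [this]
  exact ins_eta 0 a w h0

theorem two_morph {n : ℕ} (A B : Bool → Bool) : IsCubeMorphism (two (n := n) A B) := by
  unfold IsCubeMorphism
  rw [Fin.forall_iff_succAbove 0]
  refine ⟨?_, ?_⟩
  · simp only [two, cor_zero]
    exact morph_coord A 0
  · rw [Fin.forall_iff_succAbove (Fin.last n)]
    refine ⟨?_, fun j => ?_⟩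
    · have : Fin.succAbove 0 (Fin.last n) = Fin.last (n + 1) := by simp
      rw [this]
      simp only [two, cor_last]
      exact morph_coord B 0
    · simp only [two, cor_mid]
      exact Or.inr ⟨_, Or.inl fun v => rfl⟩

theorem two_inj {n : ℕ} (A B : Bool → Bool) (h : ∀ b b', A b = A b' → B b = B b' → b = b') :
    Function.Injective (two (n := n) A B) := by
  intro w w' hw
  have h0 := congrFun hw 0
  have h1 := congrFun hw (Fin.last (n + 1))
  simp only [two, cor_zero, cor_last] at h0 h1
  have e := h _ _ h0 h1
  funext j
  revert j
  rw [Fin.forall_iff_succAbove 0]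
  refine ⟨e, fun j => ?_⟩
  have h2 := congrFun hw (Fin.succAbove 0 ((Fin.last n).succAbove j))
  simp only [two, cor_mid] at h2
  exact h2

theorem two_ins {n : ℕ} (A B : Bool → Bool) (t : Bool) :
    two (n := n) A B ∘ ins 0 t = cor (A t) (B t) := by
  funext v
  simp only [two, Function.comp, ins_same, ins_above]

theorem ins_morph {n : ℕ} (i : Fin (n + 1)) (t : Bool) : IsCubeMorphism (ins (n := n) i t) := by
  unfold IsCubeMorphism
  rw [Fin.forall_iff_succAbove i]
  refine ⟨Or.inl ⟨t, fun v => ins_same _ _ _⟩, fun j => Or.inr ⟨j, Or.inl fun v => ins_above _ _ _ _⟩⟩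

theorem ins_inj {n : ℕ} (i : Fin (n + 1)) (t : Bool) : Function.Injective (ins (n := n) i t) := by
  intro v w h
  funext j
  have := congrFun h (i.succAbove j)
  rwa [ins_above, ins_above] at this

theorem cor_morph {n : ℕ} (a b : Bool) : IsCubeMorphism (cor (n := n) a b) := by
  unfold IsCubeMorphism
  rw [Fin.forall_iff_succAbove 0]
  refine ⟨Or.inl ⟨a, fun v => cor_zero _ _ _⟩, ?_⟩
  rw [Fin.forall_iff_succAbove (Fin.last n)]
  refine ⟨Or.inl ⟨b, fun v => by rw [cor, ins_above, ins_same]⟩,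
    fun j => Or.inr ⟨j, Or.inl fun v => cor_mid _ _ _ _⟩⟩

theorem cor_inj {n : ℕ} (a b : Bool) : Function.Injective (cor (n := n) a b) :=
  fun _ _ h => ins_inj _ _ (ins_inj _ _ h)

/-- move coordinate `0` to coordinate `i`. -/
def mv {n : ℕ} (i : Fin (n + 1)) (w : Fin (n + 1) → Bool) : Fin (n + 1) → Bool :=
  ins i (w 0) fun j => w (Fin.succAbove 0 j)

theorem mv_morph {n : ℕ} (i : Fin (n + 1)) : IsCubeMorphism (mv i) := by
  unfold IsCubeMorphism
  rw [Fin.forall_iff_succAbove i]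
  exact ⟨Or.inr ⟨0, Or.inl fun v => ins_same _ _ _⟩,
    fun j => Or.inr ⟨_, Or.inl fun v => ins_above _ _ _ _⟩⟩

theorem mv_inj {n : ℕ} (i : Fin (n + 1)) : Function.Injective (mv i) := by
  intro w w' hw
  funext j
  revert j
  rw [Fin.forall_iff_succAbove 0]
  refine ⟨?_, fun j => ?_⟩
  · have := congrFun hw i
    simpa only [mv, ins_same] using this
  · have := congrFun hw (i.succAbove j)
    simpa only [mv, ins_above] using this

theorem mv_ins {n : ℕ} (i : Fin (n + 1)) (t : Bool) : mv i ∘ ins 0 t = ins i t := by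
  funext v
  simp only [mv, Function.comp, ins_same, ins_above]

variable {Ω : Type*} [mΩ : MeasurableSpace Ω] {lam : Measure Ω} [IsProbabilityMeasure lam]
  {μ : (n : ℕ) → Measure ((Fin n → Bool) → Ω)}

theorem prob (hμ : IsCubicCoupling lam μ) (n : ℕ) : IsProbabilityMeasure (μ n) := by
  have h := hμ.coupling n (fun _ => false)
  have h2 : ((μ n).map fun ω => ω (fun _ => false)) univ = 1 := by rw [h]; simp
  rw [Measure.map_apply (measurable_pi_apply _) MeasurableSet.univ] at h2
  exact ⟨by simpa using h2⟩

theorem int_pres (hμ : IsCubicCoupling lam μ) {m n : ℕ} {φ : (Fin m → Bool) → (Fin n → Bool)}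
    (h1 : IsCubeMorphism φ) (h2 : Function.Injective φ) {F : ((Fin m → Bool) → Ω) → ℝ}
    (hF : Measurable F) : ∫ x, F (x ∘ φ) ∂(μ n) = ∫ y, F y ∂(μ m) := by
  rw [← hμ.consistency φ h1 h2, integral_map (measurable_precomp φ).aemeasurable
    hF.aestronglyMeasurable]

theorem ae_pres (hμ : IsCubicCoupling lam μ) {m n : ℕ} {φ : (Fin m → Bool) → (Fin n → Bool)}
    (h1 : IsCubeMorphism φ) (h2 : Function.Injective φ) {F G : ((Fin m → Bool) → Ω) → ℝ}
    (hF : Measurable F) (hG : Measurable G) :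
    (∀ᵐ x ∂(μ n), F (x ∘ φ) = G (x ∘ φ)) ↔ F =ᵐ[μ m] G := by
  rw [← hμ.consistency φ h1 h2]
  exact (ae_map_iff (measurable_precomp φ).aemeasurable (measurableSet_eq_fun hF hG)).symm

theorem adj (hμ : IsCubicCoupling lam μ) {m n : ℕ} {φ : (Fin (n + 1) → Bool) → (Fin m → Bool)}
    (h1 : IsCubeMorphism φ) (h2 : Function.Injective φ) {f g : ((Fin n → Bool) → Ω) → ℝ}
    (hf : BM univ f) (hg : BM univ g) (s t : Bool) :
    ∫ x, f (x ∘ φ ∘ ins 0 s) * g (x ∘ φ ∘ ins 0 t) ∂(μ m) =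
      ∫ x, f (x ∘ ins 0 s) * g (x ∘ ins 0 t) ∂(μ (n + 1)) :=
  int_pres hμ h1 h2 (F := fun x => f (x ∘ ins 0 s) * g (x ∘ ins 0 t))
    ((hf.meas.comp (measurable_precomp _)).mul (hg.meas.comp (measurable_precomp _)))

theorem exists_P0 [Nonempty Ω] (hμ : IsCubicCoupling lam μ) {n : ℕ} {f : ((Fin n → Bool) → Ω) → ℝ}
    (hf : BM univ f) : ∃ h, BM univ h ∧ ∀ g, BM univ g →
      ∫ x, f (x ∘ ins 0 true) * g (x ∘ ins 0 false) ∂(μ (n + 1)) = ∫ x, h x * g x ∂(μ n) := by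
  have := prob hμ (n + 1)
  obtain ⟨h, hh, -, hh'⟩ := exists_ce (μ (n + 1)) {w : Fin (n + 1) → Bool | w 0 = false}
    (hf.comp (ins 0 true) (T' := univ) (fun _ _ => mem_univ _))
  have hH : BM univ (fun y : (Fin n → Bool) → Ω =>
      h (y ∘ fun (w : Fin (n + 1) → Bool) j => w (Fin.succAbove 0 j))) :=
    hh.comp _ fun _ _ => mem_univ _
  refine ⟨_, hH, fun g hg => ?_⟩
  rw [hh' _ (hg.comp (ins 0 false) fun v _ => ins_same _ _ _),
    ← int_pres hμ (ins_morph 0 false) (ins_inj 0 false) (hH.mul hg).meas]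
  congr 1; ext x
  try simp only [Pi.mul_apply]
  congr 1
  refine hh.dep _ _ fun w hw => ?_
  simp only [Function.comp]
  rw [ins_eta 0 false w hw]

theorem key_P [Nonempty Ω] (hμ : IsCubicCoupling lam μ) {n : ℕ}
    {f g Pf Pg : ((Fin n → Bool) → Ω) → ℝ}
    (hf : BM univ f) (hg : BM univ g) (hPf : BM univ Pf) (hPg : BM univ Pg)
    (h1 : ∀ k, BM univ k →
      ∫ x, f (x ∘ ins 0 true) * k (x ∘ ins 0 false) ∂(μ (n + 1)) = ∫ x, Pf x * k x ∂(μ n))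
    (h2 : ∀ k, BM univ k →
      ∫ x, g (x ∘ ins 0 true) * k (x ∘ ins 0 false) ∂(μ (n + 1)) = ∫ x, Pg x * k x ∂(μ n)) :
    ∫ x, Pf x * g x ∂(μ n) = ∫ x, Pf x * Pg x ∂(μ n) := by
  have := prob hμ n
  have := prob hμ (n + 2)
  obtain ⟨k, hk, hk'⟩ := botRel_test (hμ.condIndep (n + 1))
    (hf.comp (cor false true) (T' := {w | w 0 = false}) fun v _ => cor_zero _ _ _)
  let K : ((Fin n → Bool) → Ω) → ℝ := fun y =>
    k (y ∘ fun (w : Fin (n + 2) → Bool) j => w (Fin.succAbove 0 ((Fin.last n).succAbove j)))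
  have hK : BM univ K := hk.comp _ fun _ _ => mem_univ _
  have ek : ∀ x, k x = K (x ∘ cor false false) := by
    intro x
    refine hk.dep _ _ fun w hw => ?_
    simp only [Function.comp]
    rw [cor_eta false false w hw.1 hw.2]
  have hKP : K =ᵐ[μ n] Pf := by
    refine ae_eq_of_test hK hPf fun G hG => ?_
    rw [← h1 G hG, ← adj hμ (two_morph (fun _ => false) id)
      (two_inj (fun _ => false) id fun _ _ _ h => h) hf hG]
    rw [two_ins, two_ins]
    simp only [id]
    rw [hk' _ (hG.comp (cor false false) fun v _ => cor_last _ _ _),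
      ← int_pres hμ (cor_morph false false) (cor_inj _ _) (hK.mul hG).meas]
    congr 1; ext x; rw [ek]
  rw [← h1 g hg, ← adj hμ (two_morph not id) (two_inj not id fun _ _ _ h => h) hf hg]
  rw [two_ins, two_ins]
  simp only [id, Bool.not_true, Bool.not_false]
  rw [hk' _ (hg.comp (cor true false) fun v _ => cor_last _ _ _)]
  simp only [ek]
  have e := adj hμ (two_morph (n := n) id (fun _ => false))
    (two_inj id (fun _ => false) fun _ _ h _ => h) hg hK true false
  rw [two_ins, two_ins, h2 K hK] at e
  simp only [id] at e
  calc _ = ∫ x, g (x ∘ cor true false) * K (x ∘ cor false false) ∂(μ (n + 2)) := by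
        congr 1; ext x; ring
    _ = _ := e
    _ = _ := integral_congr_ae (by filter_upwards [hKP] with x hx; rw [hx]; ring)

theorem exists_P [Nonempty Ω] (hμ : IsCubicCoupling lam μ) {n : ℕ} (i : Fin (n + 1))
    {f : ((Fin n → Bool) → Ω) → ℝ} (hf : BM univ f) :
    ∃ h, BM univ h ∧ (∀ g, BM univ g →
      ∫ x, f (x ∘ ins i true) * g (x ∘ ins i false) ∂(μ (n + 1)) = ∫ x, h x * g x ∂(μ n)) ∧
      ((fun x => h (x ∘ ins i false)) =ᵐ[μ (n + 1)] fun x => h (x ∘ ins i true)) ∧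
      ∫ x, f (x ∘ ins i true) * f (x ∘ ins i false) ∂(μ (n + 1)) = ∫ x, h x * h x ∂(μ n) := by
  have := prob hμ n
  have := prob hμ (n + 1)
  have tr : ∀ {f g : ((Fin n → Bool) → Ω) → ℝ}, BM univ f → BM univ g →
      ∫ x, f (x ∘ ins i true) * g (x ∘ ins i false) ∂(μ (n + 1)) =
      ∫ x, f (x ∘ ins 0 true) * g (x ∘ ins 0 false) ∂(μ (n + 1)) := by
    intro f g hf hg
    rw [← adj hμ (mv_morph i) (mv_inj i) hf hg, mv_ins, mv_ins]
  obtain ⟨h, hh, hh'⟩ := exists_P0 hμ hf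
  obtain ⟨q, hq, hq'⟩ := exists_P0 hμ hh
  have comm : ∀ a b : ((Fin n → Bool) → Ω) → ℝ,
      ∫ x, a x * b x ∂(μ n) = ∫ x, b x * a x ∂(μ n) := by
    intro a b; congr 1; ext x; ring
  have hqh : ∫ x, q x * h x ∂(μ n) = ∫ x, h x * h x ∂(μ n) := by
    have k1 := key_P hμ hh hh hq hq hq' hq'
    have k2 := key_P hμ hh hf hq hh hq' hh'
    have k3 := key_P hμ hf hh hh hq hh' hq'
    rw [k3, comm]
  refine ⟨h, hh, fun g hg => by rw [tr hf hg, hh' g hg], ?_, ?_⟩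
  · refine ae_eq_of_sq (hh.comp _ fun _ _ => mem_univ _) (hh.comp _ fun _ _ => mem_univ _) ?_
    have e1 := int_pres hμ (ins_morph i false) (ins_inj i false) (hh.mul hh).meas
    have e2 := int_pres hμ (ins_morph i true) (ins_inj i true) (hh.mul hh).meas
    have e3 := tr hh hh
    rw [hq' h hh, hqh] at e3
    rw [e1, e2]
    have e4 : ∫ x, h (x ∘ ins i false) * h (x ∘ ins i true) ∂(μ (n + 1)) =
        ∫ x, h x * h x ∂(μ n) := by
      rw [← e3]; congr 1; ext x; ring
    rw [e4]; ring
  · rw [tr hf hf, hh' f hf]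
    exact key_P hμ hf hf hh hh hh' hh'


theorem split_prod {n : ℕ} (i : Fin (n + 1)) (q : (Fin (n + 1) → Bool) → ℝ) :
    ∏ w, q w = (∏ v, q (ins i true v)) * ∏ v, q (ins i false v) := by
  rw [← (Fin.insertNthEquiv (fun _ => Bool) i).prod_comp, Fintype.prod_prod_type, Fintype.prod_bool]
  rfl

theorem ins_zero {n : ℕ} (i : Fin (n + 1)) : ins i false (fun _ : Fin n => false) = fun _ => false :=
  ins_eta i false (fun _ => false) rfl

theorem coupled_side [Nonempty Ω] (hμ : IsCubicCoupling lam μ) {n : ℕ} (i : Fin (n + 1))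
    {f : Ω → ℝ} (hf : Measurable f) (hfb : ∃ C, ∀ x, |f x| ≤ C)
    {h : ((Fin (n + 1) → Bool) → Ω) → ℝ} (hh : BM {w | w ≠ fun _ => false} h)
    (hh' : ∀ g, BM {w | w ≠ fun _ => false} g →
      ∫ x, f (x fun _ => false) * g x ∂(μ (n + 1)) = ∫ x, h x * g x ∂(μ (n + 1))) :
    ∃ u, BM {w | w i = false} u ∧ h =ᵐ[μ (n + 1)] u := by
  have := prob hμ n
  have := prob hμ (n + 1)
  set L : Set (Fin (n + 1) → Bool) := {w | w ≠ fun _ => false} with hL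
  set M := meetAlg (μ (n + 1)) (cylinderAlg (Ω := Ω) (Fin (n + 1) → Bool) univ)
    (cylinderAlg (Fin (n + 1) → Bool) L) with hM
  set B : MeasurableSpace ((Fin n → Bool) → Ω) :=
    MeasurableSpace.map (fun x => x ∘ ins i false) M ⊓ MeasurableSpace.pi with hB
  have hBpi : B ≤ MeasurableSpace.pi := inf_le_right
  have cyluniv : ∀ s : Set ((Fin (n + 1) → Bool) → Ω), MeasurableSet[MeasurableSpace.pi] s →
      MeasurableSet[cylinderAlg (Fin (n + 1) → Bool) univ] s := by
    intro s hs
    refine ⟨(fun (y : ↥(univ : Set (Fin (n + 1) → Bool)) → Ω) (v : Fin (n + 1) → Bool) =>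
      y ⟨v, mem_univ v⟩) ⁻¹' s,
      ?_, rfl⟩
    exact (measurable_pi_lambda _ fun v => measurable_pi_apply _) hs
  have memB : ∀ (p : ((Fin n → Bool) → Ω) → ℝ) (q : ((Fin (n + 1) → Bool) → Ω) → ℝ),
      Measurable[MeasurableSpace.pi] p → BM L q → ((fun x => p (x ∘ ins i false)) =ᵐ[μ (n + 1)] q) →
      Measurable[B] p := by
    intro p q hp hq hpq s hs
    refine MeasurableSpace.measurableSet_inf.2 ⟨?_, hp hs⟩
    rw [MeasurableSpace.map_def]
    have hms : MeasurableSet[MeasurableSpace.pi] ((fun x : (Fin (n + 1) → Bool) → Ω => x ∘ ins i false) ⁻¹' (p ⁻¹' s)) :=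
      (measurable_precomp _) (hp hs)
    refine ⟨hms, ⟨_, cyluniv _ hms, by simp⟩, ⟨q ⁻¹' s, hq.cyl hs, ?_⟩⟩
    rw [measure_symmDiff_eq_zero_iff]
    filter_upwards [hpq] with x hx
    apply propext
    change p (x ∘ ins i false) ∈ s ↔ q x ∈ s
    rw [← hx]
  have hf0 : BM univ (fun y : (Fin n → Bool) → Ω => f (y fun _ => false)) :=
    BM.eval (mem_univ _) hf hfb
  obtain ⟨u, hu1, hu2, hu3⟩ := exists_trunc (μ := μ n) (m := B) hf0.bdd
  have hu : BM univ u := ⟨hu1.mono hBpi le_rfl, hu2, fun x y hxy => by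
    rw [funext fun v => hxy v (mem_univ v)]⟩
  have hU : BM {w | w i = false} (fun x : (Fin (n + 1) → Bool) → Ω => u (x ∘ ins i false)) :=
    hu.comp _ fun v _ => ins_same _ _ _
  have hUu := hU.mono (subset_univ _)
  obtain ⟨U', hU', hU'e, -⟩ := exists_ce (μ (n + 1)) L hUu
  have hUM : Measurable[M] (fun x : (Fin (n + 1) → Bool) → Ω => u (x ∘ ins i false)) := by
    intro s hs
    have := hu1 hs
    exact (MeasurableSpace.measurableSet_inf.1 this).1
  have e1 : U' =ᵐ[μ (n + 1)] (fun x : (Fin (n + 1) → Bool) → Ω => u (x ∘ ins i false)) := by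
    have := meet_condExp (μ := μ (n + 1)) (T1 := univ) (T2 := L) (by
      rintro s ⟨_, _, t, ht, hst⟩
      rw [univ_inter]
      exact ⟨t, ht, hst⟩) hUu
    rw [univ_inter] at this
    refine hU'e.trans (this.trans ?_)
    rw [condExp_of_stronglyMeasurable meet_le hUM.stronglyMeasurable (hUu.integrable _)]
  refine ⟨_, hU, Filter.EventuallyEq.trans (ae_eq_of_test hh hU' fun g hg => ?_) e1⟩
  rw [← hh' g hg]
  have e2 : ∫ x, U' x * g x ∂(μ (n + 1)) = ∫ x, u (x ∘ ins i false) * g x ∂(μ (n + 1)) :=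
    integral_congr_ae (by filter_upwards [e1] with x hx; rw [hx])
  rw [e2]
  refine box (T := L) (BM.eval (mem_univ _) hf hfb) hUu ?_ g hg
  intro G hG1 hG2 hG3
  let a : ((Fin n → Bool) → Ω) → ℝ := fun y => ∏ v, G (ins i true v) (y v)
  let b : ((Fin n → Bool) → Ω) → ℝ := fun y => ∏ v, G (ins i false v) (y v)
  have ha : BM univ a := BM.prod _ fun v _ => BM.eval (mem_univ _) (hG1 _) (hG2 _)
  have hb : BM {v | v ≠ fun _ => false} b := by
    refine BM.prod _ fun v _ => ?_
    by_cases hv : v = fun _ => false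
    · have : G (ins i false v) = fun _ => 1 := hG3 _ (by rw [hv, ins_zero]; simp [hL])
      simp only [this]
      exact BM.const _ _
    · exact BM.eval hv (hG1 _) (hG2 _)
  have hbu := hb.mono (subset_univ _)
  have hsp : ∀ x : (Fin (n + 1) → Bool) → Ω,
      ∏ w, G w (x w) = a (x ∘ ins i true) * b (x ∘ ins i false) := fun x =>
    split_prod i fun w => G w (x w)
  obtain ⟨P, hP, hP1, hP2, -⟩ := exists_P hμ i ha
  have hPB : Measurable[B] P := by
    refine memB P _ hP.meas (hP.comp (ins i true) ?_) hP2
    intro v _ h0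
    have := congrFun h0 i
    rw [ins_same] at this
    exact Bool.noConfusion this
  have hbB : Measurable[B] b := by
    refine memB b (fun x => b (x ∘ ins i false)) hb.meas (hb.comp _ ?_) (Filter.EventuallyEq.refl _ _)
    intro v hv h0
    apply hv
    rw [← ins_zero i] at h0
    exact ins_inj _ _ h0
  have hbP : BM univ fun y => b y * P y := hbu.mul hP
  have k1 := hP1 _ (hf0.mul hbu)
  have k2 := hP1 _ (hu.mul hbu)
  have k3 : ∫ y, f (y fun _ => false) * (b y * P y) ∂(μ n) = ∫ y, u y * (b y * P y) ∂(μ n) := by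
    rw [integral_condExp_mul hBpi hf0 hbP (hbB.mul hPB).stronglyMeasurable]
    exact integral_congr_ae (by filter_upwards [hu3] with x hx; rw [hx])
  have k4 : ∫ x, P x * (f (x fun _ => false) * b x) ∂(μ n) = ∫ x, P x * (u x * b x) ∂(μ n) := by
    rw [← sub_eq_zero] at k3 ⊢
    rw [← k3]
    congr 1 <;> congr 1 <;> ext x <;> ring
  rw [← k1, ← k2] at k4
  simp only [hsp]
  calc _ = _ := ?_
    _ = _ := k4
    _ = _ := ?_
  · congr 1; ext x
    simp only [Function.comp_def, ins_zero]; ring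
  · congr 1; ext x; ring

theorem perm_morph {n : ℕ} (σ : Fin n → Fin n) :
    IsCubeMorphism (fun w : Fin n → Bool => w ∘ σ) :=
  fun j => Or.inr ⟨σ j, Or.inl fun _ => rfl⟩

theorem meet_two_faces [Nonempty Ω] (hμ : IsCubicCoupling lam μ) {n : ℕ} (i : Fin n)
    {f g : ((Fin (n + 1) → Bool) → Ω) → ℝ} (hf : BM {w | w 0 = false} f)
    (hg : BM {w | w i.succ = false} g) (hfg : f =ᵐ[μ (n + 1)] g) :
    ∃ k, BM {w | w 0 = false ∧ w i.succ = false} k ∧ f =ᵐ[μ (n + 1)] k := by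
  have := prob hμ (n + 1)
  set σ := Equiv.swap i.succ (Fin.last n) with hσ
  have hlast : Fin.last n ≠ 0 := by
    have := i.pos
    intro h
    have := congrArg Fin.val h
    simp at this
    omega
  have hσ0 : σ 0 = 0 := Equiv.swap_apply_of_ne_of_ne (Fin.succ_ne_zero i).symm hlast.symm
  have hσ1 : σ i.succ = Fin.last n := Equiv.swap_apply_left _ _
  have hσ2 : σ (Fin.last n) = i.succ := Equiv.swap_apply_right _ _
  have hinv : ∀ j, σ (σ j) = j := fun j =>
    DFunLike.congr_fun (Equiv.swap_swap i.succ (Fin.last n)) j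
  let φ : (Fin (n + 1) → Bool) → (Fin (n + 1) → Bool) := fun w => w ∘ σ
  have hφ1 : IsCubeMorphism φ := perm_morph σ
  have hφφ : ∀ w, φ (φ w) = w := fun w => by
    funext j
    simp only [φ, Function.comp, hinv]
  have hφ2 : Function.Injective φ := fun a b hab => by rw [← hφφ a, hab, hφφ]
  have hf' : BM {w | w 0 = false} fun x : (Fin (n + 1) → Bool) → Ω => f (x ∘ φ) :=
    hf.comp φ fun v hv => by
      change v (σ 0) = false
      rw [hσ0]; exact hv
  have hg' : BM {w | w (Fin.last n) = false} fun x : (Fin (n + 1) → Bool) → Ω => g (x ∘ φ) :=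
    hg.comp φ fun v hv => by
      change v (σ (Fin.last n)) = false
      rw [hσ2]; exact hv
  have hfg' := (ae_pres hμ hφ1 hφ2 hf.meas hg.meas).2 hfg
  obtain ⟨k, hk, hk'⟩ := botRel_test (hμ.condIndep n) hf'
  have e : (fun x => g (x ∘ φ)) =ᵐ[μ (n + 1)] k := by
    refine ae_eq_of_test hg' (hk.mono inter_subset_right) fun q hq => ?_
    rw [← hk' q hq]
    exact integral_congr_ae (by filter_upwards [hfg'] with x hx; rw [hx])
  have hk2 : BM {w | w 0 = false ∧ w i.succ = false}
      (fun x : (Fin (n + 1) → Bool) → Ω => k (x ∘ φ)) :=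
    hk.comp φ fun v hv => by
      refine ⟨?_, ?_⟩
      · change v (σ 0) = false
        rw [hσ0]; exact hv.1
      · change v (σ i.succ) = false
        rw [hσ1]; exact hv.2
  refine ⟨_, hk2, (ae_pres hμ hφ1 hφ2 hf.meas hk2.meas).1 ?_⟩
  filter_upwards [hfg', e] with x h1 h2
  rw [h1, h2]
  congr 1
  funext w
  simp only [Function.comp_apply, hφφ]

theorem meet_corner [Nonempty Ω] (hμ : IsCubicCoupling lam μ) (n : ℕ) :
    ∀ u : ((Fin n → Bool) → Ω) → ℝ, BM univ u →
    (∀ i, ∃ v, BM {w | w i = false} v ∧ u =ᵐ[μ n] v) →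
    ∃ u' : Ω → ℝ, Measurable u' ∧ (∃ C, ∀ x, |u' x| ≤ C) ∧
      u =ᵐ[μ n] fun x => u' (x fun _ => false) := by
  induction n with
  | zero =>
    intro u hu _
    refine ⟨fun y => u fun _ => y, hu.meas.comp (measurable_pi_lambda _ fun _ => measurable_id), ?_, ?_⟩
    · obtain ⟨C, hC⟩ := hu.bdd
      exact ⟨C, fun x => hC _⟩
    · refine Filter.Eventually.of_forall fun x => hu.dep _ _ fun v _ => ?_
      rw [Subsingleton.elim v fun _ => false]
  | succ n ih =>
    intro u hu hui
    obtain ⟨u0, hu0, hu0e⟩ := hui 0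
    let d : (Fin (n + 1) → Bool) → (Fin n → Bool) := fun w j => w (Fin.succAbove 0 j)
    have back : ∀ (q : ((Fin (n + 1) → Bool) → Ω) → ℝ), BM {w | w 0 = false} q → ∀ x,
        q x = q ((x ∘ ins 0 false) ∘ d) := by
      intro q hq x
      refine hq.dep _ _ fun w hw => ?_
      simp only [Function.comp, d]
      rw [ins_eta 0 false w hw]
    have ht : BM univ fun y : (Fin n → Bool) → Ω => u0 (y ∘ d) := hu0.comp d fun _ _ => mem_univ _
    obtain ⟨u', h1, h2, h3⟩ := ih _ ht (fun i => by
      obtain ⟨v, hv, hve⟩ := hui i.succ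
      obtain ⟨k, hk, hke⟩ := meet_two_faces hμ i hu0 hv (hu0e.symm.trans hve)
      have hk' : BM {w : Fin n → Bool | w i = false} fun y : (Fin n → Bool) → Ω => k (y ∘ d) :=
        hk.comp d fun w hw => by
          change w (Fin.succAbove 0 i) = false
          rw [Fin.succAbove_zero]
          exact hw.2
      refine ⟨_, hk', (ae_pres hμ (ins_morph 0 false) (ins_inj 0 false) ht.meas hk'.meas).1 ?_⟩
      filter_upwards [hke] with x hx
      rw [← back u0 hu0, ← back k (hk.mono fun w hw => hw.1), hx])
    refine ⟨u', h1, h2, hu0e.trans ?_⟩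
    have h4 := (ae_pres hμ (ins_morph 0 false) (ins_inj 0 false) ht.meas
      (h1.comp (measurable_pi_apply _))).2 h3
    filter_upwards [h4] with x hx
    rw [back u0 hu0 x, hx]
    simp only [Function.comp, ins_zero]

theorem corner [Nonempty Ω] (hμ : IsCubicCoupling lam μ) (n : ℕ)
    {f : Ω → ℝ} (hf : Measurable f) (hfb : ∃ C, ∀ x, |f x| ≤ C) :
    ∃ (u : Ω → ℝ) (h : ((Fin n → Bool) → Ω) → ℝ), Measurable u ∧ (∃ C, ∀ x, |u x| ≤ C) ∧
      BM {w | w ≠ fun _ => false} h ∧ (h =ᵐ[μ n] fun x => u (x fun _ => false)) ∧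
      ∀ g, BM {w | w ≠ fun _ => false} g →
        ∫ x, f (x fun _ => false) * g x ∂(μ n) = ∫ x, h x * g x ∂(μ n) := by
  have := prob hμ n
  obtain ⟨h, hh, -, hh'⟩ := exists_ce (μ n) {w | w ≠ fun _ => false}
    (BM.eval (v := fun _ => false) (mem_univ _) hf hfb)
  obtain ⟨u, h1, h2, h3⟩ := meet_corner hμ n h (hh.mono (subset_univ _)) (fun i => by
    cases n with
    | zero => exact i.elim0
    | succ n => exact coupled_side hμ i hf hfb hh hh')
  exact ⟨u, h, h1, h2, hh, h3, hh'⟩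

theorem cs_step [Nonempty Ω] (hμ : IsCubicCoupling lam μ) {n : ℕ} (i : Fin n)
    (g : (Fin n → Bool) → Ω → ℝ) (hg : ∀ w, Measurable (g w)) (hgb : ∀ w, ∃ C, ∀ x, |g w x| ≤ C)
    (h0 : ∫ x, ∏ w, g (Function.update w i true) (x w) ∂(μ n) = 0) :
    ∫ x, ∏ w, g w (x w) ∂(μ n) = 0 := by
  cases n with
  | zero => exact i.elim0
  | succ n =>
  have := prob hμ n
  have hupd : ∀ (t : Bool) v, Function.update (ins i t v) i true = ins i true v := by
    intro t v
    funext j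
    revert j
    rw [Fin.forall_iff_succAbove i]
    refine ⟨by simp [ins_same], fun j => ?_⟩
    rw [Function.update_of_ne (Fin.succAbove_ne i j), ins_above, ins_above]
  let a : Bool → ((Fin n → Bool) → Ω) → ℝ := fun t y => ∏ v, g (ins i t v) (y v)
  have ha : ∀ t, BM univ (a t) := fun t =>
    BM.prod _ fun v _ => BM.eval (mem_univ _) (hg _) (hgb _)
  obtain ⟨P, hP, hP1, -, hP3⟩ := exists_P hμ i (ha true)
  have e1 : ∀ x : (Fin (n + 1) → Bool) → Ω, ∏ w, g w (x w) =
      a true (x ∘ ins i true) * a false (x ∘ ins i false) := fun x =>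
    split_prod i fun w => g w (x w)
  have e2 : ∀ x : (Fin (n + 1) → Bool) → Ω, ∏ w, g (Function.update w i true) (x w) =
      a true (x ∘ ins i true) * a true (x ∘ ins i false) := fun x => by
    rw [split_prod i fun w => g (Function.update w i true) (x w)]
    simp only [hupd]
    rfl
  simp only [e2] at h0
  rw [hP3] at h0
  rw [integral_eq_zero_iff_of_nonneg (fun x => mul_self_nonneg _)
    ((hP.mul hP).integrable _)] at h0
  simp only [e1]
  rw [hP1 _ (ha false)]
  rw [← integral_zero ((Fin n → Bool) → Ω) ℝ (μ := μ n)]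
  refine integral_congr_ae ?_
  filter_upwards [h0] with x hx
  have : P x = 0 := by simpa using hx
  rw [this, zero_mul]

theorem cs_many [Nonempty Ω] (hμ : IsCubicCoupling lam μ) {n : ℕ} (K : Finset (Fin n)) :
    ∀ (g : (Fin n → Bool) → Ω → ℝ), (∀ w, Measurable (g w)) → (∀ w, ∃ C, ∀ x, |g w x| ≤ C) →
    ∫ x, ∏ w, g (fun j => w j || decide (j ∈ K)) (x w) ∂(μ n) = 0 →
    ∫ x, ∏ w, g w (x w) ∂(μ n) = 0 := by
  induction K using Finset.induction_on with
  | empty => intro g _ _ h; simpa using h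
  | insert i K hi ih =>
    intro g hg hgb h
    refine cs_step hμ i g hg hgb ?_
    refine ih (fun w => g (Function.update w i true)) (fun w => hg _) (fun w => hgb _) ?_
    rw [← h]
    congr 1; ext x
    refine Finset.prod_congr rfl fun w _ => ?_
    congr 1
    congr 1
    funext j
    by_cases hj : j = i
    · subst hj; simp
    · simp [hj]

/-- coordinatewise order on the cube -/
def Sub {m : ℕ} (w v : Fin m → Bool) : Prop := ∀ i, w i = true → v i = true

theorem Sub.antisymm {m : ℕ} {w v : Fin m → Bool} (h1 : Sub w v) (h2 : Sub v w) : w = v := by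
  funext i
  have a := h1 i
  have b := h2 i
  cases hw : w i <;> cases hv : v i <;> simp_all

theorem down_set [Nonempty Ω] (hμ : IsCubicCoupling lam μ) {m : ℕ} (v : Fin m → Bool)
    {f : Ω → ℝ} (hf : Measurable f) (hfb : ∃ C, ∀ x, |f x| ≤ C) :
    ∃ (u : Ω → ℝ) (h : ((Fin m → Bool) → Ω) → ℝ), Measurable u ∧ (∃ C, ∀ x, |u x| ≤ C) ∧
      BM {w | Sub w v ∧ w ≠ v} h ∧ (h =ᵐ[μ m] fun x => u (x v)) ∧
      ∀ g, BM {w | Sub w v ∧ w ≠ v} g →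
        ∫ x, f (x v) * g x ∂(μ m) = ∫ x, h x * g x ∂(μ m) := by
  classical
  let k := Fintype.card {i // v i = true}
  let e : Fin k ≃ {i // v i = true} := (Fintype.equivFin _).symm
  let φ : (Fin k → Bool) → (Fin m → Bool) := fun w i =>
    if h : v i = true then !(w (e.symm ⟨i, h⟩)) else false
  let θ : (Fin m → Bool) → (Fin k → Bool) := fun w j => !(w (e j))
  have hφ1 : IsCubeMorphism φ := by
    intro i
    by_cases h : v i = true
    · exact Or.inr ⟨e.symm ⟨i, h⟩, Or.inr fun w => by simp only [φ, h, dite_true]⟩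
    · exact Or.inl ⟨false, fun w => by simp only [φ, h]; rfl⟩
  have hθφ : ∀ w, θ (φ w) = w := by
    intro w; funext j
    have : v (e j) = true := (e j).2
    simp [θ, φ, this]
  have hφ2 : Function.Injective φ := fun a b hab => by rw [← hθφ a, hab, hθφ]
  have hφ0 : φ (fun _ => false) = v := by
    funext i
    by_cases h : v i = true
    · simp [φ, h]
    · simp [φ, h]
  have hφs : ∀ w, Sub (φ w) v := by
    intro w i hi
    by_contra h
    simp [φ, h] at hi
  have hφθ : ∀ w, Sub w v → φ (θ w) = w := by
    intro w hw; funext i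
    by_cases h : v i = true
    · simp [φ, θ, h]
    · have : w i = false := by
        cases hwi : w i
        · rfl
        · exact absurd (hw i hwi) h
      simp [φ, h, this]
  obtain ⟨u, h, hu1, hu2, hh, hhe, hh'⟩ := corner hμ k hf hfb
  refine ⟨u, fun x => h (x ∘ φ), hu1, hu2, hh.comp φ fun w hw => ⟨hφs w, fun hv => hw ?_⟩, ?_, ?_⟩
  · rw [← hφ0] at hv
    exact hφ2 hv
  · have := (ae_pres hμ hφ1 hφ2 hh.meas (hu1.comp (measurable_pi_apply _))).2 hhe
    filter_upwards [this] with x hx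
    rw [hx]
    simp only [Function.comp_apply, hφ0]
  · intro g hg
    have hg2 : BM {w | w ≠ fun _ => false} fun y : (Fin k → Bool) → Ω => g (y ∘ θ) :=
      hg.comp θ fun w hw h0 => hw.2 (by rw [← hφθ w hw.1, h0, hφ0])
    have eg : ∀ x, g x = g ((x ∘ φ) ∘ θ) := fun x => hg.dep _ _ fun w hw => by
      simp only [Function.comp_apply, hφθ w hw.1]
    have k1 := int_pres hμ hφ1 hφ2 (F := fun y => f (y fun _ => false) * g (y ∘ θ))
      ((hf.comp (measurable_pi_apply _)).mul hg2.meas)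
    have k2 := int_pres hμ hφ1 hφ2 (F := fun y => h y * g (y ∘ θ)) (hh.meas.mul hg2.meas)
    rw [← hh' _ hg2, ← k1] at k2
    simp only [← eg] at k2
    rw [k2]
    simp only [Function.comp_apply, hφ0]

theorem not_above [Nonempty Ω] (hμ : IsCubicCoupling lam μ) {m : ℕ} (v : Fin m → Bool)
    {f : Ω → ℝ} (hf : Measurable f) (hfb : ∃ C, ∀ x, |f x| ≤ C) :
    ∃ h : ((Fin m → Bool) → Ω) → ℝ, BM {w | Sub w v ∧ w ≠ v} h ∧
      ∀ g, BM {w | ¬ Sub v w} g →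
        ∫ x, f (x v) * g x ∂(μ m) = ∫ x, h x * g x ∂(μ m) := by
  classical
  have := prob hμ m
  obtain ⟨u, h, hu1, hu2, hh, hhe, hh'⟩ := down_set hμ v hf hfb
  refine ⟨h, hh, ?_⟩
  have hfv : BM univ fun x : (Fin m → Bool) → Ω => f (x v) := BM.eval (mem_univ _) hf hfb
  have huv : BM univ fun x : (Fin m → Bool) → Ω => u (x v) := BM.eval (mem_univ _) hu1 hu2
  set q : Ω → ℝ := fun y => f y - u y with hq
  have hqm : Measurable q := hf.sub hu1
  have hqb : ∃ C, ∀ x, |q x| ≤ C := by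
    obtain ⟨C, hC⟩ := hfb
    obtain ⟨D, hD⟩ := hu2
    exact ⟨C + D, fun x => (abs_sub _ _).trans (add_le_add (hC x) (hD x))⟩
  have hB : ∀ g, BM {w | Sub w v ∧ w ≠ v} g → ∫ x, q (x v) * g x ∂(μ m) = 0 := by
    intro g hg
    have hgu := hg.mono (subset_univ _)
    have k1 : ∫ x, h x * g x ∂(μ m) = ∫ x, u (x v) * g x ∂(μ m) :=
      integral_congr_ae (by filter_upwards [hhe] with x hx; rw [hx])
    have k2 := hh' g hg
    rw [k1, ← sub_eq_zero, ← integral_sub ((hfv.mul hgu).integrable _)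
      ((huv.mul hgu).integrable _)] at k2
    rw [← k2]
    congr 1; ext x; simp only [hq]; ring
  have hC : ∀ g, BM {w | ¬ Sub v w} g → ∫ x, q (x v) * g x ∂(μ m) = ∫ x, (0 : ℝ) * g x ∂(μ m) := by
    refine box (BM.eval (mem_univ _) hqm hqb) (BM.const _ 0) ?_
    intro G hG1 hG2 hG3
    simp only [zero_mul, integral_zero]
    let g : (Fin m → Bool) → Ω → ℝ := fun w => if w = v then q else G w
    have eg : ∀ x : (Fin m → Bool) → Ω, q (x v) * ∏ w, G w (x w) = ∏ w, g w (x w) := by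
      intro x
      have hGv : G v = fun _ => 1 := hG3 v (fun hn => hn fun _ h => h)
      rw [← Finset.mul_prod_erase _ _ (Finset.mem_univ v),
        ← Finset.mul_prod_erase _ (fun w => g w (x w)) (Finset.mem_univ v), hGv, one_mul]
      simp only [g, if_true]
      congr 1
      refine Finset.prod_congr rfl fun w hw => ?_
      rw [if_neg (Finset.ne_of_mem_erase hw)]
    simp only [eg]
    have hgm : ∀ w, Measurable (g w) := by
      intro w; by_cases hw : w = v
      · simp only [g, hw, if_true]; exact hqm
      · simp only [g, hw, if_false]; exact hG1 w
    have hgb : ∀ w, ∃ C, ∀ x, |g w x| ≤ C := by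
      intro w; by_cases hw : w = v
      · simp only [g, hw, if_true]; exact hqb
      · simp only [g, hw, if_false]; exact hG2 w
    refine cs_many hμ (Finset.univ.filter fun i => v i = true) g hgm hgb ?_
    have e2 : ∀ w : Fin m → Bool, g (fun j => w j || decide (j ∈ Finset.univ.filter fun i => v i = true))
        = if Sub w v then q else fun _ => 1 := by
      intro w
      have e3 : (fun j => w j || decide (j ∈ Finset.univ.filter fun i => v i = true)) =
          fun j => w j || v j := by
        funext j; simp
      rw [e3]
      by_cases hw : Sub w v
      · have : (fun j => w j || v j) = v := by
          funext j
          have := hw j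
          cases hwj : w j <;> simp_all
        simp only [g, this, hw, if_true]
      · have hne : (fun j => w j || v j) ≠ v := by
          intro he
          apply hw
          intro i hi
          have := congrFun he i
          simp only [hi, Bool.true_or] at this
          exact this.symm
        simp only [g, hne, hw, if_false]
        refine hG3 _ (fun hn => hn fun i hi => ?_)
        simp [hi]
    simp only [e2]
    have e4 := hB (fun x => ∏ w ∈ Finset.univ.erase v,
        (if Sub w v then q else fun _ => (1 : ℝ)) (x w)) (by
      refine BM.prod _ fun w hw => ?_
      by_cases hwv : Sub w v
      · simp only [hwv, if_true]
        have hm : w ∈ {w | Sub w v ∧ w ≠ v} := ⟨hwv, Finset.ne_of_mem_erase hw⟩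
        exact BM.eval hm hqm hqb
      · simp only [hwv, if_false]
        exact BM.const _ _)
    rw [← e4]
    congr 1; ext x
    rw [← Finset.mul_prod_erase _ _ (Finset.mem_univ v), if_pos (show Sub v v from fun _ h => h)]
  intro g hg
  have hgu := hg.mono (subset_univ _)
  have k1 : ∫ x, h x * g x ∂(μ m) = ∫ x, u (x v) * g x ∂(μ m) :=
    integral_congr_ae (by filter_upwards [hhe] with x hx; rw [hx])
  have k2 := hC g hg
  simp only [zero_mul, integral_zero] at k2
  rw [k1, ← sub_eq_zero, ← integral_sub ((hfv.mul hgu).integrable _)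
      ((huv.mul hgu).integrable _), ← k2]
  congr 1; ext x; simp only [hq]; ring

theorem simp_test [Nonempty Ω] (hμ : IsCubicCoupling lam μ) {m : ℕ} (H2 : Set (Fin m → Bool))
    (hH2 : IsSimplicial H2) (N : ℕ) : ∀ H1 : Set (Fin m → Bool), IsSimplicial H1 →
    (H1 \ H2).ncard = N → ∀ f : ((Fin m → Bool) → Ω) → ℝ, BM H1 f →
    ∃ k, BM (H1 ∩ H2) k ∧ ∀ g, BM H2 g → ∫ x, f x * g x ∂(μ m) = ∫ x, k x * g x ∂(μ m) := by
  classical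
  have := prob hμ m
  induction N with
  | zero =>
    intro H1 _ hN f hf
    have h0 : H1 \ H2 = ∅ := (Set.ncard_eq_zero (Set.toFinite _)).1 hN
    exact ⟨f, hf.mono fun w hw => ⟨hw, sdiff_eq_bot_iff.1 h0 hw⟩, fun g _ => rfl⟩
  | succ N ih =>
    intro H1 hH1 hN f hf
    have hne : (H1 \ H2).Nonempty := by
      rw [Set.nonempty_iff_ne_empty]
      intro h0
      rw [h0] at hN
      simp at hN
    obtain ⟨v, hv, hmax⟩ := (Set.toFinite (H1 \ H2)).exists_maximal hne
    have up : ∀ w ∈ H1, Sub v w → w = v := by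
      intro w hw hvw
      have h2 : w ∉ H2 := fun h => hv.2 (hH2 w h v hvw)
      have hle : v ≤ w := fun i => Bool.le_iff_imp.2 (hvw i)
      have := hmax ⟨hw, h2⟩ hle
      exact Sub.antisymm (fun i => Bool.le_iff_imp.1 (this i)) hvw
    set H1' := H1 \ {v} with hH1'
    have hs : IsSimplicial H1' := by
      intro w hw w' hw'
      refine ⟨hH1 w hw.1 w' hw', fun h => hw.2 ?_⟩
      have h : w' = v := h
      subst h
      exact up w hw.1 hw'
    have hcard : (H1' \ H2).ncard = N := by
      have : H1' \ H2 = (H1 \ H2) \ {v} := by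
        ext w; simp only [hH1', mem_diff]; tauto
      rw [this, Set.ncard_diff_singleton_of_mem hv, hN]
      simp
    have hinter : H1' ∩ H2 = H1 ∩ H2 := by
      ext w
      simp only [hH1', mem_inter_iff, mem_diff, mem_singleton_iff]
      constructor
      · rintro ⟨⟨a, _⟩, b⟩; exact ⟨a, b⟩
      · rintro ⟨a, b⟩; exact ⟨⟨a, fun h => hv.2 (h ▸ b)⟩, b⟩
    have hS : H1' ∪ H2 ⊆ {w | ¬ Sub v w} := by
      rintro w (hw | hw) hvw
      · exact hw.2 (up w hw.1 hvw)
      · exact hv.2 (hH2 w hw v hvw)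
    have hD : {w | Sub w v ∧ w ≠ v} ⊆ H1' := fun w hw => ⟨hH1 v hv.1 w hw.1, hw.2⟩
    have hfu := hf.mono (subset_univ _)
    obtain ⟨f', hf', -, hff⟩ := exists_ce (μ m) H1' hfu
    obtain ⟨k, hk, hkk⟩ := ih H1' hs hcard f' hf'
    rw [hinter] at hk
    refine ⟨k, hk, fun g hg => ?_⟩
    rw [← hkk g hg]
    have hgu := hg.mono (subset_univ _)
    obtain ⟨g', hg', -, hgg⟩ := exists_ce (μ m) H1' hgu
    have comm : ∀ a b : ((Fin m → Bool) → Ω) → ℝ,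
        ∫ x, a x * b x ∂(μ m) = ∫ x, b x * a x ∂(μ m) := by
      intro a b; congr 1; ext x; ring
    have main : ∫ x, g x * f x ∂(μ m) = ∫ x, g' x * f x ∂(μ m) := by
      refine box hgu (hg'.mono (subset_univ _)) ?_ f hf
      intro G hG1 hG2 hG3
      obtain ⟨h, hh, hh'⟩ := not_above hμ v (hG1 v) (hG2 v)
      let b : ((Fin m → Bool) → Ω) → ℝ := fun x => ∏ w ∈ Finset.univ.erase v, G w (x w)
      have hb : BM H1' b := by
        refine BM.prod _ fun w hw => ?_
        by_cases hw1 : w ∈ H1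
        · have hm : w ∈ H1' := ⟨hw1, Finset.ne_of_mem_erase hw⟩
          exact BM.eval hm (hG1 _) (hG2 _)
        · rw [hG3 w hw1]
          exact BM.const _ _
      have eG : ∀ x : (Fin m → Bool) → Ω, ∏ w, G w (x w) = G v (x v) * b x := fun x =>
        (Finset.mul_prod_erase _ _ (Finset.mem_univ v)).symm
      simp only [eG]
      have k1 := hh' (fun x => b x * g x)
        (((hb.mono subset_union_left).mul (hg.mono subset_union_right)).mono hS)
      have k2 := hh' (fun x => b x * g' x) ((hb.mul hg').mono (subset_union_left.trans hS))
      have k3 := hgg (fun x => h x * b x) ((hh.mono hD).mul hb)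
      calc ∫ x, g x * (G v (x v) * b x) ∂(μ m) = ∫ x, G v (x v) * (b x * g x) ∂(μ m) := by
            congr 1; ext x; ring
        _ = ∫ x, h x * (b x * g x) ∂(μ m) := k1
        _ = ∫ x, g x * (h x * b x) ∂(μ m) := by congr 1; ext x; ring
        _ = ∫ x, g' x * (h x * b x) ∂(μ m) := k3
        _ = ∫ x, h x * (b x * g' x) ∂(μ m) := by congr 1; ext x; ring
        _ = ∫ x, G v (x v) * (b x * g' x) ∂(μ m) := k2.symm
        _ = _ := by congr 1; ext x; ring
    rw [comm f g, main, comm g' f, hff g' hg', comm f' g', ← hgg f' hf', comm g f']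

end cubes

end CubicAux

/-- **Conditional independence of simplicial sets in a cubic coupling** (Theorem 3.9).
For any cubic coupling `(μ^⟦n⟧)` on a probability space and any `m ≥ 1`, any two
simplicial subsets `H₁, H₂ ⊆ {0,1}^m` satisfy `H₁ ⊥_{μ^⟦m⟧} H₂`. -/
theorem simplicial_sets_botRel
    {Ω : Type*} [mΩ : MeasurableSpace Ω] (lam : Measure Ω) [IsProbabilityMeasure lam]
    (μ : (n : ℕ) → Measure ((Fin n → Bool) → Ω)) (hμ : IsCubicCoupling lam μ)
    (m : ℕ) (hm : 1 ≤ m)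
    (H1 H2 : Set (Fin m → Bool)) (hH1 : IsSimplicial H1) (hH2 : IsSimplicial H2) :
    BotRel (μ m) H1 H2 := by
  have := nonempty_of_isProbabilityMeasure lam
  have := CubicAux.prob hμ m
  exact CubicAux.botRel_of_test fun f hf =>
    CubicAux.simp_test hμ H2 hH2 _ H1 hH1 rfl f hf
end

section
/- Let (Ω, 𝒜, λ) be a probability space, let (μ^⟦n⟧)_{n≥0} be a cubic coupling on it, and let m ≥ 1. Then every face F of {0,1}^m is local in μ^⟦m⟧: for every w ∈ {0,1}^m ∖ F, the σ-algebras 𝒜^S_F and 𝒜^S_{{w}} (with S = {0,1}^m) are independent in μ^⟦m⟧, i.e. μ^⟦m⟧(A ∩ B) = μ^⟦m⟧(A) · μ^⟦m⟧(B) for all A ∈ 𝒜^S_F and B ∈ 𝒜^S_{{w}}. -/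
open MeasureTheory Set

/-- A face of the discrete cube `{0,1}^m`: the set of vertices agreeing with a fixed
vertex on a fixed set of coordinates. -/
def IsCubeFace {m : ℕ} (F : Set (Fin m → Bool)) : Prop :=
  ∃ (J : Set (Fin m)) (w₀ : Fin m → Bool), F = {v | ∀ i ∈ J, v i = w₀ i}

open ProbabilityTheory

theorem cyl_eq_iSup {Ω ι : Type*} [mΩ : MeasurableSpace Ω] (T : Set ι) :
    cylinderAlg (Ω := Ω) ι T = ⨆ v ∈ T, MeasurableSpace.comap (fun ω : ι → Ω => ω v) mΩ := by
  unfold cylinderAlg MeasurableSpace.pi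
  rw [MeasurableSpace.comap_iSup, iSup_subtype']
  congr 1
  ext1 a
  rw [MeasurableSpace.comap_comp]
  rfl

theorem cyl_le {Ω ι : Type*} [mΩ : MeasurableSpace Ω] (T : Set ι) :
    cylinderAlg (Ω := Ω) ι T ≤ MeasurableSpace.pi := by
  rw [cyl_eq_iSup]
  exact iSup₂_le fun v _ => (measurable_pi_apply v).comap_le

theorem cyl_mono {Ω ι : Type*} [mΩ : MeasurableSpace Ω] {T T' : Set ι} (h : T ⊆ T') :
    cylinderAlg (Ω := Ω) ι T ≤ cylinderAlg ι T' := by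
  rw [cyl_eq_iSup, cyl_eq_iSup]
  exact biSup_mono h

theorem cyl_singleton {Ω ι : Type*} [mΩ : MeasurableSpace Ω] (v : ι) :
    cylinderAlg (Ω := Ω) ι {v} = MeasurableSpace.comap (fun ω : ι → Ω => ω v) mΩ := by
  rw [cyl_eq_iSup]; simp

theorem cyl_image {Ω ι κ : Type*} [mΩ : MeasurableSpace Ω] (φ : ι → κ) (T : Set ι) :
    cylinderAlg (Ω := Ω) κ (Set.image φ T) =
      MeasurableSpace.comap (fun ω => ω ∘ φ) (cylinderAlg ι T) := by
  rw [cyl_eq_iSup, cyl_eq_iSup, iSup_image]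
  simp only [MeasurableSpace.comap_iSup, MeasurableSpace.comap_comp]
  rfl

theorem transport {Ω : Type*} [mΩ : MeasurableSpace Ω] {lam : Measure Ω}
    {μ : (n : ℕ) → Measure ((Fin n → Bool) → Ω)} (hμ : IsCubicCoupling lam μ)
    {m n : ℕ} (φ : (Fin m → Bool) → (Fin n → Bool)) (h1 : IsCubeMorphism φ)
    (h2 : Function.Injective φ) (T1 T2 : Set (Fin m → Bool))
    (h : Indep (cylinderAlg _ T1) (cylinderAlg _ T2) (μ m)) :
    Indep (cylinderAlg _ (Set.image φ T1)) (cylinderAlg _ (Set.image φ T2)) (μ n) := by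
  have hmeas : Measurable (fun ω : (Fin n → Bool) → Ω => ω ∘ φ) :=
    measurable_pi_lambda _ fun v => measurable_pi_apply (φ v)
  rw [cyl_image, cyl_image]
  rw [Indep_iff] at h ⊢
  rintro _ _ ⟨A, hA, rfl⟩ ⟨B, hB, rfl⟩
  have := h A B hA hB
  have hA' := cyl_le _ _ hA
  have hB' := cyl_le _ _ hB
  rw [← hμ.consistency φ h1 h2, Measure.map_apply hmeas hA', Measure.map_apply hmeas hB',
    Measure.map_apply hmeas (hA'.inter hB')] at this
  exact this

theorem prob_of {Ω : Type*} [mΩ : MeasurableSpace Ω] {lam : Measure Ω} [IsProbabilityMeasure lam]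
    {μ : (n : ℕ) → Measure ((Fin n → Bool) → Ω)} (hμ : IsCubicCoupling lam μ) (n : ℕ) :
    IsProbabilityMeasure (μ n) := by
  constructor
  have h := hμ.coupling n (fun _ => false)
  have h2 := congrArg (fun ν => ν Set.univ) h
  rw [Measure.map_apply (measurable_pi_apply _) MeasurableSet.univ] at h2
  simpa using h2

/-- The vertex `(1,0,…,0)`. -/
def eVert (m : ℕ) : Fin (m + 1) → Bool := fun i => decide (i = 0)

theorem indep_step {α : Type*} {mα : MeasurableSpace α} (ν : Measure α) [IsProbabilityMeasure ν]
    (B0 B1 C D : MeasurableSpace α) (hB0 : B0 ≤ mα) (hD : D ≤ mα) (hD1 : D ≤ B1)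
    (hc : CondIndepRel ν B0 B1 (meetAlg ν B0 B1))
    (he : EqModNull ν (meetAlg ν B0 B1) C) (hi : Indep C D ν) : Indep B0 D ν := by
  have hM : meetAlg ν B0 B1 ≤ mα := fun s hs => hs.1
  have hi' : Indep D (meetAlg ν B0 B1) ν := by
    rw [Indep_iff] at hi ⊢
    intro s t hs ht
    obtain ⟨u, hu, hut⟩ := he.1 t ht
    have h1 : t =ᵐ[ν] u := measure_symmDiff_eq_zero_iff.1 hut
    rw [measure_congr h1, measure_congr ((ae_eq_refl s).inter h1), inter_comm, hi u s hu hs,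
      mul_comm]
  rw [Indep_iff]
  intro A B hA hB
  have hf : Measurable[B0] (A.indicator (fun _ => (1:ℝ))) :=
    (@measurable_const _ _ _ B0 _).indicator hA
  have hg : Measurable[D] (B.indicator (fun _ => (1:ℝ))) :=
    (@measurable_const _ _ _ D _).indicator hB
  have hbd : ∀ S : Set α, ∃ C, ∀ x, |S.indicator (fun _ => (1:ℝ)) x| ≤ C := fun S =>
    ⟨1, fun x => by by_cases h : x ∈ S <;> simp [h]⟩
  have key := hc _ _ hf (hg.mono hD1 le_rfl) (hbd A) (hbd B)
  have hconst := condExp_indep_eq hD hM hg.stronglyMeasurable hi'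
  have hint := integral_congr_ae key
  rw [integral_condExp hM] at hint
  have h3 : ∫ x, (ν[A.indicator (fun _ => (1:ℝ))|meetAlg ν B0 B1]) x *
      (ν[B.indicator (fun _ => (1:ℝ))|meetAlg ν B0 B1]) x ∂ν = ν.real A * ν.real B := by
    have : ∀ᵐ x ∂ν, (ν[A.indicator (fun _ => (1:ℝ))|meetAlg ν B0 B1]) x *
      (ν[B.indicator (fun _ => (1:ℝ))|meetAlg ν B0 B1]) x =
      (ν[A.indicator (fun _ => (1:ℝ))|meetAlg ν B0 B1]) x * ν.real B := by
      filter_upwards [hconst] with x hx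
      rw [hx, integral_indicator_const _ (hD _ hB)]; simp
    rw [integral_congr_ae this, integral_mul_const, integral_condExp hM,
      integral_indicator_const _ (hB0 _ hA)]
    simp
  have h4 : (fun x => A.indicator (fun _ => (1:ℝ)) x * B.indicator (fun _ => (1:ℝ)) x) =
      (A ∩ B).indicator (fun _ => (1:ℝ)) := by
    ext x
    by_cases ha : x ∈ A <;> by_cases hb : x ∈ B <;> simp [ha, hb]
  rw [h3, h4, integral_indicator_const _ ((hB0 _ hA).inter (hD _ hB))] at hint
  simp only [smul_eq_mul, mul_one, measureReal_def] at hint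
  rw [← ENNReal.toReal_mul] at hint
  exact (ENNReal.toReal_eq_toReal_iff' (measure_ne_top _ _)
    (ENNReal.mul_ne_top (measure_ne_top _ _) (measure_ne_top _ _))).1 hint

theorem main_ind {Ω : Type*} [mΩ : MeasurableSpace Ω] {lam : Measure Ω} [IsProbabilityMeasure lam]
    {μ : (n : ℕ) → Measure ((Fin n → Bool) → Ω)} (hμ : IsCubicCoupling lam μ) (m : ℕ) :
    Indep (cylinderAlg _ {v : Fin (m + 1) → Bool | v 0 = false})
      (cylinderAlg _ {eVert m}) (μ (m + 1)) := by
  induction m with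
  | zero =>
    have h0 : {v : Fin (0 + 1) → Bool | v 0 = false} = {fun _ => false} := by
      ext v
      simp only [mem_ofPred_eq, mem_singleton_iff]
      constructor
      · intro h; ext i; rw [show i = 0 by omega, h]
      · rintro rfl; rfl
    rw [h0, cyl_singleton, cyl_singleton]
    have h1 : iIndepFun (fun (v : Fin (0 + 1) → Bool) (ω : (Fin (0 + 1) → Bool) → Ω) => ω v)
        (μ (0 + 1)) := by
      have := hμ.ergodicity
      rw [this]
      exact iIndepFun_pi (X := fun _ => id) (fun _ => aemeasurable_id)
    have hne : (fun _ => false : Fin (0 + 1) → Bool) ≠ eVert 0 := by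
      intro h; have := congrFun h 0; simp [eVert] at this
    exact h1.indepFun hne
  | succ m ih =>
    have := prob_of hμ (m + 1 + 1)
    let φ : (Fin (m + 1) → Bool) → (Fin (m + 1 + 1) → Bool) := fun v => Fin.snoc v false
    have h1 : IsCubeMorphism φ := by
      intro j
      refine Fin.lastCases ?_ (fun i => ?_) j
      · exact Or.inl ⟨false, fun v => by simp [φ]⟩
      · exact Or.inr ⟨i, Or.inl fun v => by simp [φ]⟩
    have h2 : Function.Injective φ := by
      intro u v h
      ext i
      have := congrFun h i.castSucc
      simpa [φ] using this
    have h3 := transport hμ φ h1 h2 _ _ ih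
    have hz : ∀ v, φ v 0 = v 0 := fun v => by
      have : φ v (Fin.castSucc 0) = v 0 := by simp only [φ, Fin.snoc_castSucc]
      exact this
    have h4 : Set.image φ {v | v 0 = false} =
        {v | v 0 = false} ∩ {v | v (Fin.last (m + 1)) = false} := by
      ext u
      simp only [mem_image, mem_ofPred_eq, mem_inter_iff]
      constructor
      · rintro ⟨v, hv, rfl⟩
        exact ⟨(hz v).trans hv, by simp [φ]⟩
      · rintro ⟨hu0, hu1⟩
        refine ⟨fun i => u i.castSucc, hu0, ?_⟩
        ext j
        refine Fin.lastCases ?_ (fun i => ?_) j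
        · simp [φ, hu1]
        · simp [φ]
    have h5 : φ (eVert m) = eVert (m + 1) := by
      ext j
      refine Fin.lastCases ?_ (fun i => ?_) j
      · simp [φ, eVert]
      · simp [φ, eVert]
    rw [image_singleton, h5, h4] at h3
    have hb := hμ.condIndep (m + 1)
    refine indep_step _ _ _ _ _ (cyl_le _) (cyl_le _) (cyl_mono ?_) hb.1 hb.2 h3
    simp [eVert]

theorem facet_indep {Ω : Type*} [mΩ : MeasurableSpace Ω] {lam : Measure Ω}
    [IsProbabilityMeasure lam]
    {μ : (n : ℕ) → Measure ((Fin n → Bool) → Ω)} (hμ : IsCubicCoupling lam μ) (m : ℕ)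
    (i : Fin (m + 1)) (w : Fin (m + 1) → Bool) :
    Indep (cylinderAlg _ {v : Fin (m + 1) → Bool | v i = !(w i)})
      (cylinderAlg _ {w}) (μ (m + 1)) := by
  let φ : (Fin (m + 1) → Bool) → (Fin (m + 1) → Bool) := fun v j =>
    xor (xor (v (Equiv.swap 0 i j)) (eVert m (Equiv.swap 0 i j))) (w j)
  have h1 : IsCubeMorphism φ := by
    intro j
    refine Or.inr ⟨Equiv.swap 0 i j, ?_⟩
    simp only [φ]
    cases eVert m (Equiv.swap 0 i j) <;> cases w j <;> simp
  have h2 : Function.Injective φ := by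
    intro u v h
    ext k
    have := congrFun h (Equiv.swap 0 i k)
    simpa [φ] using this
  have h3 := transport hμ φ h1 h2 _ _ (main_ind hμ m)
  have h4 : {v : Fin (m + 1) → Bool | v i = !(w i)} ⊆ Set.image φ {v | v 0 = false} := by
    intro u hu
    refine ⟨fun k => xor (xor (u (Equiv.swap 0 i k)) (w (Equiv.swap 0 i k))) (eVert m k), ?_, ?_⟩
    · simp only [mem_ofPred_eq] at hu ⊢
      simp [hu, eVert]
    · ext j
      simp [φ]
  have h5 : φ (eVert m) = w := by
    ext j
    simp [φ]
  rw [image_singleton, h5] at h3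
  exact indep_of_indep_of_le_left h3 (cyl_mono h4)

/-- **Faces are local in a cubic coupling** (Corollary 3.10). For every cubic coupling
`(μ^⟦n⟧)`, every `m ≥ 1`, every face `F ⊆ {0,1}^m` and every vertex `w ∉ F`, the
σ-algebras `𝒜^S_F` and `𝒜^S_{{w}}` are independent in `μ^⟦m⟧`. -/
theorem faces_are_local
    {Ω : Type*} [mΩ : MeasurableSpace Ω] (lam : Measure Ω) [IsProbabilityMeasure lam]
    (μ : (n : ℕ) → Measure ((Fin n → Bool) → Ω)) (hμ : IsCubicCoupling lam μ)
    (m : ℕ) (hm : 1 ≤ m) (F : Set (Fin m → Bool)) (hF : IsCubeFace F)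
    (w : Fin m → Bool) (hw : w ∉ F) :
    ∀ A B : Set ((Fin m → Bool) → Ω),
      MeasurableSet[cylinderAlg (Fin m → Bool) F] A →
      MeasurableSet[cylinderAlg (Fin m → Bool) ({w} : Set (Fin m → Bool))] B →
      μ m (A ∩ B) = μ m A * μ m B := by
  obtain ⟨J, w₀, rfl⟩ := hF
  obtain ⟨k, rfl⟩ : ∃ k, m = k + 1 := ⟨m - 1, by omega⟩
  simp only [mem_ofPred_eq, not_forall] at hw
  obtain ⟨i, hi, hne⟩ := hw
  have h := indep_of_indep_of_le_left (facet_indep hμ k i w)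
    (cyl_mono (T := {v | ∀ i ∈ J, v i = w₀ i}) (fun v hv => by
      have := hv i hi
      simp only [mem_ofPred_eq, this]
      revert hne
      cases w i <;> cases w₀ i <;> simp))
  rw [Indep_iff] at h
  exact fun A B hA hB => h A B hA hB
end

section
/- Let G be a group and let G_• = (G_i)_{i≥0} be a filtration on G. For n, k ≥ 0 let H_{n,k} be the subgroup of the direct power G^{{0,1}^n} generated by the elements g^F, where F ranges over faces of {0,1}^n of any dimension d, g ranges over G_{(n−d)+k}, and g^F is defined by g^F(v) = g for v ∈ F and g^F(v) = 1 otherwise. Then (H_{n,k})_{k≥0} is a filtration on H_{n,0}: H_{n,k+1} ≤ H_{n,k} for all k ≥ 0, and [H_{n,j}, H_{n,k}] ≤ H_{n,j+k} for all j, k ≥ 0. -/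
/-- A filtration on a group `G`: a decreasing sequence of subgroups with
`[G_i, G_j] ≤ G_{i+j}`. -/
def IsGroupFiltration {G : Type*} [Group G] (Gf : ℕ → Subgroup G) : Prop :=
  (∀ i, Gf (i + 1) ≤ Gf i) ∧ ∀ i j, ⁅Gf i, Gf j⁆ ≤ Gf (i + j)

/-- The Host–Kra cube group `H_{n,k} = cu^n(G_•^{+k})`: the subgroup of `G^{{0,1}^n}`
generated by the elements `g^F` for `F` a face of `{0,1}^n` of dimension `d` (cut out by
a finite set `J` of fixed coordinates, so `d = n - |J|`) and `g ∈ G_{(n-d)+k} = G_{|J|+k}`,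
where `g^F` takes the value `g` on `F` and `1` elsewhere. -/
def hostKraCube {G : Type*} [Group G] (Gf : ℕ → Subgroup G) (n k : ℕ) :
    Subgroup ((Fin n → Bool) → G) :=
  Subgroup.closure
    {x | ∃ (J : Finset (Fin n)) (w₀ : Fin n → Bool) (g : G), g ∈ Gf (J.card + k) ∧
      x = fun v => if ∀ i ∈ J, v i = w₀ i then g else 1}

open scoped commutatorElement

theorem hk_comm_closure {A : Type*} [Group A] (S T : Set A) (N : Subgroup A)
    (hS : ∀ g ∈ Subgroup.closure S, ∀ x ∈ N, g * x * g⁻¹ ∈ N)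
    (hT : ∀ g ∈ Subgroup.closure T, ∀ x ∈ N, g * x * g⁻¹ ∈ N)
    (h : ∀ s ∈ S, ∀ t ∈ T, ⁅s, t⁆ ∈ N) :
    ⁅Subgroup.closure S, Subgroup.closure T⁆ ≤ N := by
  have h1 : ∀ s ∈ S, ∀ y ∈ Subgroup.closure T, ⁅s, y⁆ ∈ N := by
    intro s hs y hy
    induction hy using Subgroup.closure_induction with
    | mem x hx => exact h s hs x hx
    | one => simp
    | mul a b ha hb iha ihb =>
      have : ⁅s, a * b⁆ = ⁅s, a⁆ * (a * ⁅s, b⁆ * a⁻¹) := by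
        simp only [commutatorElement_def]; group
      rw [this]
      exact N.mul_mem iha (hT a ha _ ihb)
    | inv a ha iha =>
      have : ⁅s, a⁻¹⁆ = a⁻¹ * ⁅s, a⁆⁻¹ * a⁻¹⁻¹ := by
        simp only [commutatorElement_def]; group
      rw [this]
      exact hT _ (Subgroup.inv_mem _ ha) _ (N.inv_mem iha)
  rw [Subgroup.commutator_le]
  intro x hx y hy
  induction hx using Subgroup.closure_induction with
  | mem x hx => exact h1 x hx y hy
  | one => simp
  | mul a b ha hb iha ihb =>
    have : ⁅a * b, y⁆ = (a * ⁅b, y⁆ * a⁻¹) * ⁅a, y⁆ := by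
      simp only [commutatorElement_def]; group
    rw [this]
    exact N.mul_mem (hS a ha _ ihb) iha
  | inv a ha iha =>
    have : ⁅a⁻¹, y⁆ = a⁻¹ * ⁅a, y⁆⁻¹ * a⁻¹⁻¹ := by
      simp only [commutatorElement_def]; group
    rw [this]
    exact hS _ (Subgroup.inv_mem _ ha) _ (N.inv_mem iha)

def hkGen {G : Type*} [Group G] (Gf : ℕ → Subgroup G) (n k : ℕ) :
    Set ((Fin n → Bool) → G) :=
  {x | ∃ (J : Finset (Fin n)) (w₀ : Fin n → Bool) (g : G), g ∈ Gf (J.card + k) ∧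
      x = fun v => if ∀ i ∈ J, v i = w₀ i then g else 1}

theorem hkGen_inv {G : Type*} [Group G] (Gf : ℕ → Subgroup G) (n k : ℕ)
    (x : (Fin n → Bool) → G) (hx : x ∈ hkGen Gf n k) : x⁻¹ ∈ hkGen Gf n k := by
  obtain ⟨J, w, g, hg, rfl⟩ := hx
  refine ⟨J, w, g⁻¹, inv_mem hg, ?_⟩
  funext v
  by_cases h : ∀ i ∈ J, v i = w i
  · simp only [Pi.inv_apply, if_pos h]
  · simp only [Pi.inv_apply, if_neg h, inv_one]

theorem hkGen_comm {G : Type*} [Group G] (Gf : ℕ → Subgroup G)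
    (hGf : IsGroupFiltration Gf) (n j k : ℕ)
    (x y : (Fin n → Bool) → G) (hx : x ∈ hkGen Gf n j) (hy : y ∈ hkGen Gf n k) :
    ⁅x, y⁆ ∈ hostKraCube Gf n (j + k) := by
  have hanti : Antitone Gf := antitone_nat_of_succ_le hGf.1
  obtain ⟨J, w, a, ha, rfl⟩ := hx
  obtain ⟨K, u, b, hb, rfl⟩ := hy
  by_cases hc : ∃ z : Fin n → Bool, (∀ i ∈ J, z i = w i) ∧ ∀ i ∈ K, z i = u i
  · obtain ⟨z, hzJ, hzK⟩ := hc
    apply Subgroup.subset_closure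
    refine ⟨J ∪ K, z, ⁅a, b⁆, ?_, ?_⟩
    · refine hanti ?_ (hGf.2 _ _ (Subgroup.commutator_mem_commutator ha hb))
      have := Finset.card_union_le J K
      omega
    · funext v
      have e1 : (∀ i ∈ J, v i = w i) ↔ ∀ i ∈ J, v i = z i :=
        forall₂_congr fun i hi => by rw [hzJ i hi]
      have e2 : (∀ i ∈ K, v i = u i) ↔ ∀ i ∈ K, v i = z i :=
        forall₂_congr fun i hi => by rw [hzK i hi]
      have e3 : (∀ i ∈ J ∪ K, v i = z i) ↔ (∀ i ∈ J, v i = z i) ∧ ∀ i ∈ K, v i = z i := by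
        simp only [Finset.mem_union, or_imp, forall_and]
      simp only [commutatorElement_def, Pi.mul_apply, Pi.inv_apply, e1, e2, e3]
      by_cases h1 : ∀ i ∈ J, v i = z i
      · by_cases h2 : ∀ i ∈ K, v i = z i
        · rw [if_pos h1, if_pos h2, if_pos ⟨h1, h2⟩]
        · rw [if_neg h2, if_neg (not_and_of_not_right _ h2)]; simp
      · rw [if_neg h1, if_neg (not_and_of_not_left _ h1)]; simp
  · convert Subgroup.one_mem _
    funext v
    simp only [commutatorElement_def, Pi.mul_apply, Pi.inv_apply, Pi.one_apply]
    by_cases h1 : ∀ i ∈ J, v i = w i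
    · have h2 : ¬ ∀ i ∈ K, v i = u i := fun h2 => hc ⟨v, h1, h2⟩
      rw [if_neg h2]; simp
    · rw [if_neg h1]; simp

theorem hk_anti {G : Type*} [Group G] (Gf : ℕ → Subgroup G)
    (hGf : IsGroupFiltration Gf) (n : ℕ) : Antitone (hostKraCube Gf n) := by
  refine antitone_nat_of_succ_le fun k => Subgroup.closure_mono ?_
  rintro x ⟨J, w, g, hg, rfl⟩
  exact ⟨J, w, g, hGf.1 _ hg, rfl⟩

theorem hk_conj {G : Type*} [Group G] (Gf : ℕ → Subgroup G)
    (hGf : IsGroupFiltration Gf) (n k : ℕ) (g : (Fin n → Bool) → G)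
    (hg : g ∈ hostKraCube Gf n 0) :
    ∀ x ∈ hostKraCube Gf n k, g * x * g⁻¹ ∈ hostKraCube Gf n k := by
  have key : ∀ g ∈ hkGen Gf n 0, ∀ x ∈ hostKraCube Gf n k,
      g * x * g⁻¹ ∈ hostKraCube Gf n k := by
    intro g hg x hx
    have : hostKraCube Gf n k ≤ (hostKraCube Gf n k).comap (MulAut.conj g).toMonoidHom := by
      refine (Subgroup.closure_le _).2 fun y hy => ?_
      have h1 := hkGen_comm Gf hGf n 0 k g y hg hy
      rw [zero_add] at h1
      have h2 := mul_mem h1 (Subgroup.subset_closure hy : y ∈ hostKraCube Gf n k)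
      simpa [commutatorElement_def] using h2
    simpa using this hx
  have hn : hostKraCube Gf n 0 ≤ Subgroup.normalizer (hostKraCube Gf n k : Set _) := by
    refine (Subgroup.closure_le _).2 fun y hy => ?_
    refine Subgroup.mem_normalizer_iff.2 fun x => ⟨key y hy x, fun h => ?_⟩
    have := key _ (hkGen_inv Gf n 0 y hy) _ h
    simpa [mul_assoc] using this
  exact fun x hx => (Subgroup.mem_normalizer_iff.1 (hn hg) x).1 hx

theorem hostKraCube_filtration {G : Type*} [Group G] (Gf : ℕ → Subgroup G)
    (hGf : IsGroupFiltration Gf) (n : ℕ) :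
    (∀ k, hostKraCube Gf n (k + 1) ≤ hostKraCube Gf n k) ∧
    ∀ j k, ⁅hostKraCube Gf n j, hostKraCube Gf n k⁆ ≤ hostKraCube Gf n (j + k) := by
  refine ⟨fun k => hk_anti Gf hGf n (Nat.le_succ k), fun j k => ?_⟩
  exact hk_comm_closure (hkGen Gf n j) (hkGen Gf n k) _
    (fun g hg => hk_conj Gf hGf n _ g (hk_anti Gf hGf n (Nat.zero_le j) hg))
    (fun g hg => hk_conj Gf hGf n _ g (hk_anti Gf hGf n (Nat.zero_le k) hg))
    (fun s hs t ht => hkGen_comm Gf hGf n j k s t hs ht)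
end

section
/- Let G be a group, let G_• = (G_i)_{i≥0} be a filtration on G, and for n, k ≥ 0 let H_{n,k} be the subgroup of G^{{0,1}^n} generated by the elements g^F with F a face of {0,1}^n of dimension d and g ∈ G_{(n−d)+k}, where g^F(v) = g for v ∈ F and g^F(v) = 1 otherwise. Identify G^{{0,1}^{n+1}} with G^{{0,1}^n} × G^{{0,1}^n} by sending ω to the pair of its restrictions to {0,1}^n × {0} and {0,1}^n × {1}. Then for all n, k ≥ 0: H_{n+1,k} = {(q·s, q·t) : q ∈ H_{n,k}, s, t ∈ H_{n,k+1}} (pointwise products in G^{{0,1}^n}). -/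
/-- The element of `G^{{0,1}^{n+1}}` corresponding, under the identification of
`{0,1}^{n+1}` with `{0,1}^n × {0,1}`, to the pair `(q, r)` of elements of
`G^{{0,1}^n}` (on the faces where the last coordinate is `0`, resp. `1`). -/
def pairCube {G : Type*} {n : ℕ} (q r : (Fin n → Bool) → G) : (Fin (n + 1) → Bool) → G :=
  fun v => if v (Fin.last n) = false then q fun i => v i.castSucc else r fun i => v i.castSucc

theorem hkc_gen_mem {G : Type*} [Group G] (Gf : ℕ → Subgroup G) {n k : ℕ}
    (J : Finset (Fin n)) (w₀ : Fin n → Bool) (g : G) (hg : g ∈ Gf (J.card + k)) :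
    (fun v => if ∀ i ∈ J, v i = w₀ i then g else 1) ∈ hostKraCube Gf n k :=
  Subgroup.subset_closure ⟨J, w₀, g, hg, rfl⟩

theorem hkc_anti {G : Type*} [Group G] {Gf : ℕ → Subgroup G}
    (hGf : IsGroupFiltration Gf) {a b : ℕ} (h : a ≤ b) : Gf b ≤ Gf a :=
  antitone_nat_of_succ_le hGf.1 h

theorem hkc_comm_mem {G : Type*} [Group G] (Gf : ℕ → Subgroup G)
    (hGf : IsGroupFiltration Gf) {n k : ℕ}
    (J K : Finset (Fin n)) (w u : Fin n → Bool) (c : G) (hc : c ∈ Gf (J.card + K.card + k)) :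
    (fun v => if (∀ i ∈ J, v i = w i) ∧ ∀ i ∈ K, v i = u i then c else 1)
      ∈ hostKraCube Gf n k := by
  by_cases hne : ∃ v₀ : Fin n → Bool, (∀ i ∈ J, v₀ i = w i) ∧ ∀ i ∈ K, v₀ i = u i
  · obtain ⟨v₀, h1, h2⟩ := hne
    have := hkc_gen_mem Gf (k := k) (J ∪ K) v₀ c
      (hkc_anti hGf (by have := Finset.card_union_le J K; omega) hc)
    convert this using 4 with v
    simp only [Finset.mem_union]
    constructor
    · rintro ⟨a, b⟩ i (hi | hi)
      · rw [a i hi, h1 i hi]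
      · rw [b i hi, h2 i hi]
    · intro a
      exact ⟨fun i hi => by rw [a i (Or.inl hi), h1 i hi],
        fun i hi => by rw [a i (Or.inr hi), h2 i hi]⟩
  · have : (fun v => if (∀ i ∈ J, v i = w i) ∧ ∀ i ∈ K, v i = u i then c else 1)
        = (1 : (Fin n → Bool) → G) := by
      funext v
      rw [if_neg (fun h => hne ⟨v, h⟩)]
      rfl
    rw [this]
    exact one_mem _

theorem hkc_gen_conj {G : Type*} [Group G] (Gf : ℕ → Subgroup G)
    (hGf : IsGroupFiltration Gf) {n k : ℕ}
    (J : Finset (Fin n)) (w : Fin n → Bool) (g : G) (hg : g ∈ Gf (J.card + k))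
    (s : (Fin n → Bool) → G) (hs : s ∈ hostKraCube Gf n (k + 1)) :
    (fun v => if ∀ i ∈ J, v i = w i then g else 1) * s *
      (fun v => if ∀ i ∈ J, v i = w i then g else 1)⁻¹ ∈ hostKraCube Gf n (k + 1) := by
  induction hs using Subgroup.closure_induction with
  | mem x hx =>
    obtain ⟨K, u, h, hh, rfl⟩ := hx
    have hc : g * h * g⁻¹ * h⁻¹ ∈ Gf (J.card + K.card + (k + 1)) :=
      hkc_anti hGf (b := J.card + k + (K.card + (k + 1))) (by omega)
        (hGf.2 _ _ (Subgroup.commutator_mem_commutator hg hh))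
    have := mul_mem (hkc_comm_mem Gf hGf J K w u _ hc) (hkc_gen_mem Gf K u h hh)
    convert this using 1
    funext v
    simp only [Pi.mul_apply, Pi.inv_apply]
    split_ifs <;> first | (exfalso; tauto) | group
  | one => simp
  | mul x y _ _ hx hy =>
    have := mul_mem hx hy
    convert this using 1
    group
  | inv x _ hx =>
    have := inv_mem hx
    convert this using 1
    group

theorem hkc_conj {G : Type*} [Group G] (Gf : ℕ → Subgroup G)
    (hGf : IsGroupFiltration Gf) {n k : ℕ}
    (q : (Fin n → Bool) → G) (hq : q ∈ hostKraCube Gf n k) :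
    q ∈ Subgroup.normalizer (hostKraCube Gf n (k + 1) : Set ((Fin n → Bool) → G)) := by
  refine (Subgroup.closure_le _).2 ?_ hq
  rintro x ⟨J, w, g, hg, rfl⟩
  rw [SetLike.mem_coe, Subgroup.mem_normalizer_iff]
  intro s
  constructor
  · exact hkc_gen_conj Gf hGf J w g hg s
  · intro h
    have := hkc_gen_conj Gf hGf J w g⁻¹ (inv_mem hg) _ h
    have e : (fun v : Fin n → Bool => if ∀ i ∈ J, v i = w i then g⁻¹ else 1)
        = (fun v => if ∀ i ∈ J, v i = w i then g else 1)⁻¹ := by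
      funext v
      simp only [Pi.inv_apply]
      split_ifs <;> simp
    rw [e] at this
    convert this using 1
    group

theorem pairCube_mul {G : Type*} [Group G] {n : ℕ} (a b c d : (Fin n → Bool) → G) :
    pairCube (a * c) (b * d) = pairCube a b * pairCube c d := by
  funext v
  simp only [pairCube, Pi.mul_apply]
  split_ifs <;> rfl

theorem pairCube_inv {G : Type*} [Group G] {n : ℕ} (a b : (Fin n → Bool) → G) :
    pairCube a⁻¹ b⁻¹ = (pairCube a b)⁻¹ := by
  funext v
  simp only [pairCube, Pi.inv_apply]
  split_ifs <;> rfl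

theorem pairCube_one {G : Type*} [Group G] {n : ℕ} :
    pairCube (1 : (Fin n → Bool) → G) 1 = 1 := by
  funext v
  simp [pairCube]

theorem pairCube_diag_mem {G : Type*} [Group G] (Gf : ℕ → Subgroup G) {n k : ℕ}
    (q : (Fin n → Bool) → G) (hq : q ∈ hostKraCube Gf n k) :
    pairCube q q ∈ hostKraCube Gf (n + 1) k := by
  induction hq using Subgroup.closure_induction with
  | mem x hx =>
    obtain ⟨K, u, h, hh, rfl⟩ := hx
    have := hkc_gen_mem Gf (k := k) (K.map Fin.castSuccEmb) (Fin.snoc u false : Fin (n+1) → Bool) h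
      (by rwa [Finset.card_map])
    convert this using 1
    funext v
    simp [pairCube]
  | one => rw [pairCube_one]; exact one_mem _
  | mul x y _ _ hx hy => rw [pairCube_mul]; exact mul_mem hx hy
  | inv x _ hx => rw [pairCube_inv]; exact inv_mem hx

theorem pairCube_side_mem {G : Type*} [Group G] (Gf : ℕ → Subgroup G) {n k : ℕ}
    (s : (Fin n → Bool) → G) (hs : s ∈ hostKraCube Gf n (k + 1)) :
    pairCube s 1 ∈ hostKraCube Gf (n + 1) k ∧ pairCube 1 s ∈ hostKraCube Gf (n + 1) k := by
  induction hs using Subgroup.closure_induction with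
  | mem x hx =>
    obtain ⟨K, u, h, hh, rfl⟩ := hx
    have key : ∀ b : Bool, _ := fun b =>
      hkc_gen_mem Gf (k := k) (insert (Fin.last n) (K.map Fin.castSuccEmb))
        (Fin.snoc u b : Fin (n+1) → Bool) h
        (by
          rw [Finset.card_insert_of_notMem (by simp [Fin.castSucc_ne_last]), Finset.card_map]
          convert hh using 2
          omega)
    constructor
    · convert key false using 1
      funext v
      cases hv : v (Fin.last n) <;> simp [pairCube, hv]
    · convert key true using 1
      funext v
      cases hv : v (Fin.last n) <;> simp [pairCube, hv]
  | one => rw [pairCube_one]; exact ⟨one_mem _, one_mem _⟩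
  | mul x y _ _ hx hy =>
    have h1 := mul_mem hx.1 hy.1
    have h2 := mul_mem hx.2 hy.2
    rw [← pairCube_mul, mul_one] at h1 h2
    exact ⟨h1, h2⟩
  | inv x _ hx =>
    have h1 := inv_mem hx.1
    have h2 := inv_mem hx.2
    rw [← pairCube_inv, inv_one] at h1 h2
    exact ⟨h1, h2⟩

theorem hkc_finset_cases {n : ℕ} (J : Finset (Fin (n + 1))) :
    ∃ K : Finset (Fin n), J = K.map Fin.castSuccEmb ∨
      J = insert (Fin.last n) (K.map Fin.castSuccEmb) := by
  refine ⟨Finset.univ.filter (fun i => i.castSucc ∈ J), ?_⟩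
  by_cases h : Fin.last n ∈ J
  · right
    ext i
    refine Fin.lastCases ?_ (fun j => ?_) i <;> simp [h, Fin.castSucc_ne_last]
  · left
    ext i
    refine Fin.lastCases ?_ (fun j => ?_) i <;> simp [h, Fin.castSucc_ne_last]

/-- **Recursive diagonal description of the Host–Kra cube groups** (Lemma 5.3).
Under the identification `G^{{0,1}^{n+1}} ≅ G^{{0,1}^n} × G^{{0,1}^n}`, one has
`H_{n+1,k} = diag(H_{n,k}, H_{n,k+1}) = {(q·s, q·t) : q ∈ H_{n,k}, s, t ∈ H_{n,k+1}}`. -/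
theorem hostKraCube_succ_eq_diag {G : Type*} [Group G] (Gf : ℕ → Subgroup G)
    (hGf : IsGroupFiltration Gf) (n k : ℕ) :
    (hostKraCube Gf (n + 1) k : Set ((Fin (n + 1) → Bool) → G)) =
      {x | ∃ q ∈ hostKraCube Gf n k, ∃ s ∈ hostKraCube Gf n (k + 1),
        ∃ t ∈ hostKraCube Gf n (k + 1), x = pairCube (q * s) (q * t)} := by
  ext x
  simp only [SetLike.mem_coe, Set.mem_ofPred_eq]
  constructor
  · intro hx
    induction hx using Subgroup.closure_induction with
    | mem x hx =>
      obtain ⟨J, w, g, hg, rfl⟩ := hx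
      obtain ⟨K, rfl | rfl⟩ := hkc_finset_cases J
      · rw [Finset.card_map] at hg
        refine ⟨_, hkc_gen_mem Gf K (fun i => w i.castSucc) g hg, 1, one_mem _, 1, one_mem _, ?_⟩
        funext v
        simp [pairCube]
      · rw [Finset.card_insert_of_notMem (by simp [Fin.castSucc_ne_last]), Finset.card_map,
          add_assoc, add_comm 1 k] at hg
        have hm := hkc_gen_mem Gf K (fun i => w i.castSucc) g hg
        cases hw : w (Fin.last n)
        · refine ⟨1, one_mem _, _, hm, 1, one_mem _, ?_⟩
          funext v
          cases hv : v (Fin.last n) <;> simp [pairCube, hv, hw]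
        · refine ⟨1, one_mem _, 1, one_mem _, _, hm, ?_⟩
          funext v
          cases hv : v (Fin.last n) <;> simp [pairCube, hv, hw]
    | one => exact ⟨1, one_mem _, 1, one_mem _, 1, one_mem _, by simp [pairCube_one]⟩
    | mul x y _ _ hx hy =>
      obtain ⟨q, hq, s, hs, t, ht, rfl⟩ := hx
      obtain ⟨q', hq', s', hs', t', ht', rfl⟩ := hy
      have hN := Subgroup.mem_normalizer_iff.1 (hkc_conj Gf hGf q'⁻¹ (inv_mem hq'))
      refine ⟨q * q', mul_mem hq hq', _, mul_mem ((hN s).1 hs) hs',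
        _, mul_mem ((hN t).1 ht) ht', ?_⟩
      rw [← pairCube_mul]
      congr 1 <;> group
    | inv x _ hx =>
      obtain ⟨q, hq, s, hs, t, ht, rfl⟩ := hx
      have hN := Subgroup.mem_normalizer_iff.1 (hkc_conj Gf hGf q hq)
      refine ⟨q⁻¹, inv_mem hq, _, (hN _).1 (inv_mem hs), _, (hN _).1 (inv_mem ht), ?_⟩
      rw [← pairCube_inv]
      congr 1 <;> group
  · rintro ⟨q, hq, s, hs, t, ht, rfl⟩
    have := mul_mem (mul_mem (pairCube_diag_mem Gf q hq) (pairCube_side_mem Gf s hs).1)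
      (pairCube_side_mem Gf t ht).2
    rw [← pairCube_mul, ← pairCube_mul] at this
    simpa using this
end

section
/- Let F₁ and F₂ be faces of ⟦ℕ⟧ such that F₁ ∩ F₂ is a face of infinite dimension, and let T ⊆ F₁ be a finite subset. Then there exists a face map τ : ⟦ℕ⟧ → ⟦ℕ⟧ such that τ(F₂) = F₁ ∩ F₂ and τ(t) = t for every t ∈ T. -/
/-- The infinite discrete cube `⟦ℕ⟧`: elements of `{0,1}^ℕ` with only finitely many
coordinates equal to `1`. -/
def FinCube : Type := {v : ℕ → Bool // {i | v i = true}.Finite}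

/-- A cube morphism `⟦ℕ⟧ → ⟦ℕ⟧` (a map extending to an affine homomorphism
`⊕_ℕ ℤ → ⊕_ℕ ℤ`): each coordinate function is constant, a coordinate of the argument, or
the negation of a coordinate; only finitely many coordinate functions are the constant `1`
or a negated coordinate; and each coordinate of the argument is used by only finitely many
coordinate functions. -/
def IsCubeMorphismInf (φ : FinCube → FinCube) : Prop :=
  (∀ j : ℕ, (∃ c, ∀ v, (φ v).1 j = c) ∨
    ∃ i : ℕ, (∀ v, (φ v).1 j = v.1 i) ∨ (∀ v, (φ v).1 j = !(v.1 i))) ∧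
  {j : ℕ | (∀ v, (φ v).1 j = true) ∨ ∃ i : ℕ, ∀ v, (φ v).1 j = !(v.1 i)}.Finite ∧
  ∀ i : ℕ, {j : ℕ | (∀ v, (φ v).1 j = v.1 i) ∨ (∀ v, (φ v).1 j = !(v.1 i))}.Finite

/-- A face map `⟦ℕ⟧ → ⟦ℕ⟧`: a cube morphism in which, for each coordinate `i` of the
argument, exactly one coordinate function depends (non-constantly) on `v(i)`. -/
def IsFaceMapInf (φ : FinCube → FinCube) : Prop :=
  IsCubeMorphismInf φ ∧
  ∀ i : ℕ, ∃! j : ℕ, (∀ v, (φ v).1 j = v.1 i) ∨ (∀ v, (φ v).1 j = !(v.1 i))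

/-- A face of `⟦ℕ⟧`: the set of elements agreeing with a fixed `z ∈ ⟦ℕ⟧` outside a set
`S'` of free coordinates. -/
def IsFaceInf (F : Set FinCube) : Prop :=
  ∃ (S' : Set ℕ) (z : FinCube), F = {v | ∀ j ∉ S', v.1 j = z.1 j}

theorem aux_main (D : Set ℕ) (z : FinCube) (f g : ℕ → ℕ) (hgD : ∀ i, g i ∈ D)
    (hfg : ∀ i, f (g i) = i) (hgf : ∀ j ∈ D, g (f j) = j) :
    ∃ τ : FinCube → FinCube, IsFaceMapInf τ ∧ (∀ v, ∀ j ∉ D, (τ v).1 j = z.1 j) ∧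
      (∀ v, ∀ j ∈ D, (τ v).1 j = xor (v.1 (f j)) (xor (z.1 (f j)) (z.1 j))) := by
  classical
  have hfin : ∀ v : FinCube, {j | (if j ∈ D then xor (v.1 (f j)) (xor (z.1 (f j)) (z.1 j))
      else z.1 j) = true}.Finite := by
    intro v
    refine ((z.2.union ((v.2.union z.2).image g))).subset ?_
    intro j hj
    by_cases hD : j ∈ D
    · simp only [Set.mem_setOf_eq, if_pos hD] at hj
      by_cases hz : z.1 j = true
      · exact Or.inl hz
      · right
        refine ⟨f j, ?_, hgf j hD⟩
        simp only [Set.mem_union, Set.mem_setOf_eq]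
        revert hj hz
        cases v.1 (f j) <;> cases z.1 (f j) <;> cases z.1 j <;> simp
    · simp only [Set.mem_setOf_eq, if_neg hD] at hj
      exact Or.inl hj
  let τ : FinCube → FinCube := fun v => ⟨_, hfin v⟩
  have h1 : ∀ v, ∀ j ∉ D, (τ v).1 j = z.1 j := fun v j hj => if_neg hj
  have h2 : ∀ v, ∀ j ∈ D, (τ v).1 j = xor (v.1 (f j)) (xor (z.1 (f j)) (z.1 j)) :=
    fun v j hj => if_pos hj
  let o : FinCube := ⟨fun _ => false, by simp⟩
  let e : ℕ → FinCube := fun i => ⟨fun k => decide (k = i), by simp⟩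
  have key : ∀ i j, ((∀ v, (τ v).1 j = v.1 i) ∨ (∀ v, (τ v).1 j = !(v.1 i))) → j = g i := by
    intro i j h
    have hne : (τ o).1 j ≠ (τ (e i)).1 j := by
      rcases h with h | h <;> rw [h, h] <;> simp [o, e]
    by_cases hD : j ∈ D
    · rw [h2 _ _ hD, h2 _ _ hD] at hne
      by_cases hf : f j = i
      · rw [← hf, hgf j hD]
      · simp [o, e, hf] at hne
    · rw [h1 _ _ hD, h1 _ _ hD] at hne
      exact absurd rfl hne
  have key2 : ∀ j ∈ D, ((∀ v, (τ v).1 j = v.1 (f j)) ∨ (∀ v, (τ v).1 j = !(v.1 (f j)))) := by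
    intro j hj
    simp only [h2 _ _ hj]
    cases z.1 (f j) <;> cases z.1 j <;> simp
  refine ⟨τ, ⟨⟨?_, ?_, ?_⟩, ?_⟩, h1, h2⟩
  · intro j
    by_cases hD : j ∈ D
    · exact Or.inr ⟨f j, key2 j hD⟩
    · exact Or.inl ⟨z.1 j, fun v => h1 v j hD⟩
  · refine (τ o).2.subset ?_
    rintro j (h | ⟨i, h⟩)
    · exact h o
    · simp [h o, o]
  · intro i
    exact (Set.finite_singleton (g i)).subset (fun j hj => key i j hj)
  · intro i
    refine ⟨g i, ?_, fun j hj => key i j hj⟩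
    have := key2 (g i) (hgD i)
    rwa [hfg] at this

theorem aux_bij (S1 S2 A : Set ℕ) (hS : (S1 ∩ S2).Infinite) (hA : A.Finite)
    (hAS : A ⊆ S1 ∩ S2) :
    ∃ f g : ℕ → ℕ, (∀ i, g i ∈ {j | j ∈ S2 → j ∈ S1}) ∧ (∀ i, f (g i) = i) ∧
      (∀ j ∈ {j | j ∈ S2 → j ∈ S1}, g (f j) = j) ∧
      (∀ j, j ∉ (S1 ∩ S2) \ A → f j = j) ∧ (∀ j ∈ (S1 ∩ S2) \ A, f j ∈ S2 \ A) ∧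
      (∀ i ∈ S2 \ A, g i ∈ (S1 ∩ S2) \ A) ∧ (∀ i, i ∉ S2 \ A → g i = i) := by
  classical
  have i1 : ((S1 ∩ S2) \ A).Infinite := hS.sdiff hA
  have i2 : (S2 \ A).Infinite := (hS.mono Set.inter_subset_right).sdiff hA
  have := i1.to_subtype
  have := i2.to_subtype
  obtain ⟨e⟩ : Nonempty (↥((S1 ∩ S2) \ A) ≃ ↥(S2 \ A)) := nonempty_equiv_of_countable
  let f : ℕ → ℕ := fun j => if h : j ∈ (S1 ∩ S2) \ A then (e ⟨j, h⟩).1 else j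
  let g : ℕ → ℕ := fun i => if h : i ∈ S2 \ A then (e.symm ⟨i, h⟩).1 else i
  have f1 : ∀ j (h : j ∈ (S1 ∩ S2) \ A), f j = (e ⟨j, h⟩).1 := fun j h => dif_pos h
  have f2 : ∀ j, j ∉ (S1 ∩ S2) \ A → f j = j := fun j h => dif_neg h
  have g1 : ∀ j (h : j ∈ S2 \ A), g j = (e.symm ⟨j, h⟩).1 := fun j h => dif_pos h
  have g2 : ∀ j, j ∉ S2 \ A → g j = j := fun j h => dif_neg h
  have f3 : ∀ j ∈ (S1 ∩ S2) \ A, f j ∈ S2 \ A := fun j h => by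
    rw [f1 j h]; exact (e ⟨j, h⟩).2
  have g3 : ∀ i ∈ S2 \ A, g i ∈ (S1 ∩ S2) \ A := fun j h => by
    rw [g1 j h]; exact (e.symm ⟨j, h⟩).2
  refine ⟨f, g, ?_, ?_, ?_, f2, f3, g3, g2⟩
  · intro i
    by_cases h : i ∈ S2 \ A
    · exact fun _ => (g3 i h).1.1
    · rw [g2 i h]
      intro h2
      by_cases hA' : i ∈ A
      · exact (hAS hA').1
      · exact absurd ⟨h2, hA'⟩ h
  · intro i
    by_cases h : i ∈ S2 \ A
    · rw [f1 _ (g3 i h)]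
      have : (⟨g i, g3 i h⟩ : ↥((S1 ∩ S2) \ A)) = e.symm ⟨i, h⟩ := Subtype.ext (g1 i h)
      rw [this, e.apply_symm_apply]
    · rw [g2 i h]
      exact f2 i (fun h' => h ⟨h'.1.2, h'.2⟩)
  · intro j hj
    by_cases h : j ∈ (S1 ∩ S2) \ A
    · rw [g1 _ (f3 j h)]
      have : (⟨f j, f3 j h⟩ : ↥(S2 \ A)) = e ⟨j, h⟩ := Subtype.ext (f1 j h)
      rw [this, e.symm_apply_apply]
    · rw [f2 j h]
      exact g2 j (fun h' => h ⟨⟨hj h'.1, h'.1⟩, h'.2⟩)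

/-- **Extension of face inclusions to face maps of the infinite cube** (Lemma 6.6).
If `F₁, F₂` are faces of `⟦ℕ⟧` such that `F₁ ∩ F₂` is a face of infinite dimension, and
`T ⊆ F₁` is finite, then there is a face map `τ : ⟦ℕ⟧ → ⟦ℕ⟧` with `τ(F₂) = F₁ ∩ F₂`
fixing `T` pointwise. -/
theorem face_map_extension
    (F1 F2 : Set FinCube) (hF1 : IsFaceInf F1) (hF2 : IsFaceInf F2)
    (hinter : ∃ (S' : Set ℕ) (z : FinCube), S'.Infinite ∧
      F1 ∩ F2 = {v | ∀ j ∉ S', v.1 j = z.1 j})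
    (T : Set FinCube) (hT : T.Finite) (hTF1 : T ⊆ F1) :
    ∃ τ : FinCube → FinCube, IsFaceMapInf τ ∧ τ '' F2 = F1 ∩ F2 ∧ ∀ t ∈ T, τ t = t := by
  classical
  obtain ⟨S1, z1, rfl⟩ := hF1
  obtain ⟨S2, z2, rfl⟩ := hF2
  obtain ⟨S', z, hS', hI⟩ := hinter
  have hz : z ∈ {v : FinCube | ∀ j ∉ S1, v.1 j = z1.1 j} ∩ {v | ∀ j ∉ S2, v.1 j = z2.1 j} := by
    rw [hI]; exact fun _ _ => rfl
  obtain ⟨hzz1, hzz2⟩ := hz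
  simp only [Set.mem_setOf_eq] at hzz1 hzz2
  have hsub : S' ⊆ S1 ∩ S2 := by
    intro s hs
    let w : FinCube := ⟨Function.update z.1 s (!(z.1 s)), by
      refine (z.2.union (Set.finite_singleton s)).subset ?_
      intro j hj
      by_cases h : j = s
      · exact Or.inr h
      · left
        simpa [Function.update_of_ne h] using hj⟩
    have hw : w ∈ {v : FinCube | ∀ j ∉ S1, v.1 j = z1.1 j} ∩
        {v | ∀ j ∉ S2, v.1 j = z2.1 j} := by
      rw [hI]
      intro j hj
      have : j ≠ s := fun h => hj (h ▸ hs)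
      simp [w, Function.update_of_ne this]
    have hws : w.1 s ≠ z.1 s := by simp [w]
    constructor
    · by_contra h
      exact hws ((hw.1 s h).trans (hzz1 s h).symm)
    · by_contra h
      exact hws ((hw.2 s h).trans (hzz2 s h).symm)
  have hS : (S1 ∩ S2).Infinite := hS'.mono hsub
  have hne : ∀ v : FinCube, {i | v.1 i ≠ z.1 i}.Finite := by
    intro v
    refine (v.2.union z.2).subset ?_
    intro i hi
    simp only [Set.mem_union, Set.mem_setOf_eq] at *
    revert hi
    cases v.1 i <;> cases z.1 i <;> simp
  let A : Set ℕ := (S1 ∩ S2) ∩ ⋃ t ∈ T, {i | t.1 i ≠ z.1 i}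
  have hA : A.Finite := (hT.biUnion (fun t _ => hne t)).subset Set.inter_subset_right
  have hTA : ∀ t ∈ T, ∀ i ∈ S2 \ A, t.1 i = z.1 i := by
    intro t ht i hi
    by_cases h1 : i ∈ S1
    · by_contra h
      exact hi.2 ⟨⟨h1, hi.1⟩, Set.mem_biUnion ht h⟩
    · exact (hTF1 ht i h1).trans (hzz1 i h1).symm
  obtain ⟨f, g, hgD, hfg, hgf, hf1, hf2, hg1, hg2⟩ :=
    aux_bij S1 S2 A hS hA Set.inter_subset_left
  obtain ⟨τ, hτ, ho, hi⟩ := aux_main _ z f g hgD hfg hgf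
  have hid : ∀ v, ∀ j, (j ∈ S2 → j ∈ S1) → j ∉ (S1 ∩ S2) \ A → (τ v).1 j = v.1 j := by
    intro v j hj hj'
    rw [hi v j hj, hf1 j hj']
    cases v.1 j <;> cases z.1 j <;> rfl
  refine ⟨τ, hτ, ?_, ?_⟩
  · ext w
    constructor
    · rintro ⟨v, hv, rfl⟩
      have hvz : ∀ j, ¬ (j ∈ S1 ∧ j ∈ S2) → (τ v).1 j = z.1 j := by
        intro j hj
        by_cases h2 : j ∈ S2
        · exact ho v j (fun h => hj ⟨h h2, h2⟩)
        · rw [hid v j (fun h => absurd h h2) (fun h => hj h.1)]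
          exact (hv j h2).trans (hzz2 j h2).symm
      exact ⟨fun j hj => (hvz j (fun h => hj h.1)).trans (hzz1 j hj),
        fun j hj => (hvz j (fun h => hj h.2)).trans (hzz2 j hj)⟩
    · rintro ⟨hw1, hw2⟩
      let v : FinCube := ⟨fun i => xor (w.1 (g i)) (xor (z.1 (g i)) (z.1 i)), by
        refine (z.2.union ((hne w).image f)).subset ?_
        intro i hi'
        by_cases h : z.1 i = true
        · exact Or.inl h
        · refine Or.inr ⟨g i, ?_, hfg i⟩
          simp only [Set.mem_setOf_eq] at *
          revert hi' h
          cases w.1 (g i) <;> cases z.1 (g i) <;> cases z.1 i <;> simp⟩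
      refine ⟨v, ?_, ?_⟩
      · intro j hj
        rw [← hw2 j hj]
        simp only [v]
        rw [hg2 j (fun h => hj h.1)]
        cases w.1 j <;> cases z.1 j <;> rfl
      · apply Subtype.ext
        funext j
        by_cases hj : j ∈ S2 → j ∈ S1
        · rw [hi v j hj]
          simp only [v]
          rw [hgf j hj]
          cases w.1 j <;> cases z.1 j <;> cases z.1 (f j) <;> rfl
        · rw [ho v j hj]
          have h1 : j ∉ S1 := fun h => hj (fun _ => h)
          exact (hzz1 j h1).trans (hw1 j h1).symm
  · intro t ht
    apply Subtype.ext
    funext j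
    by_cases hj : j ∈ S2 → j ∈ S1
    · by_cases hj' : j ∈ (S1 ∩ S2) \ A
      · rw [hi t j hj, hTA t ht _ (hf2 j hj'), hTA t ht j ⟨hj'.1.2, hj'.2⟩]
        cases z.1 j <;> cases z.1 (f j) <;> rfl
      · exact hid t j hj hj'
    · rw [ho t j hj]
      have h1 : j ∉ S1 := fun h => hj (fun _ => h)
      exact (hzz1 j h1).trans (hTF1 ht j h1).symm
end

section
/- Let Q be a standard Borel space, let 𝒫(Q) be the set of Borel probability measures on Q equipped with the σ-algebra generated by the evaluation maps μ′ ↦ μ′(A) for measurable A ⊆ Q, let μ ∈ 𝒫(Q), and let κ be a probability measure on 𝒫(Q) such that for every measurable set E ⊆ Q × Q one has ∫_{𝒫(Q)} (μ′ × μ′)(E) dκ(μ′) = (μ × μ)(E). Then κ is the Dirac measure concentrated at μ. -/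
open MeasureTheory

lemma ae_eval_eq {Q : Type*} [MeasurableSpace Q]
    (μ : Measure Q) (hμ : IsProbabilityMeasure μ)
    (κ : Measure {ν : Measure Q // IsProbabilityMeasure ν}) [IsProbabilityMeasure κ]
    (havg : ∀ E : Set (Q × Q), MeasurableSet E →
      ∫⁻ ν : {ν : Measure Q // IsProbabilityMeasure ν}, (ν.1.prod ν.1) E ∂κ =
        (μ.prod μ) E) (A : Set Q) (hA : MeasurableSet A) :
    ∀ᵐ ν ∂κ, ν.1 A = μ A := by
  have hP : ∀ ν : {ν : Measure Q // IsProbabilityMeasure ν}, IsProbabilityMeasure ν.1 :=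
    fun ν => ν.2
  have hmeas : Measurable (fun ν : {ν : Measure Q // IsProbabilityMeasure ν} => ν.1 A) :=
    (Measure.measurable_coe hA).comp measurable_subtype_coe
  have h1 : ∫⁻ ν, ν.1 A ∂κ = μ A := by
    have := havg (A ×ˢ Set.univ) (hA.prod MeasurableSet.univ)
    simpa [Measure.prod_prod] using this
  have h2 : ∫⁻ ν, ν.1 A * ν.1 A ∂κ = μ A * μ A := by
    have := havg (A ×ˢ A) (hA.prod hA)
    simpa [Measure.prod_prod] using this
  set f : {ν : Measure Q // IsProbabilityMeasure ν} → ℝ := fun ν => (ν.1 A).toReal with hf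
  have hfm : Measurable f := hmeas.ennreal_toReal
  have hbd : ∀ ν, ‖f ν‖ ≤ 1 := fun ν => by
    rw [Real.norm_of_nonneg ENNReal.toReal_nonneg]
    exact measureReal_le_one (μ := ν.1)
  have hfi : Integrable f κ := Integrable.of_bound hfm.aestronglyMeasurable 1 (ae_of_all _ hbd)
  have hffi : Integrable (fun ν => f ν * f ν) κ := by
    refine Integrable.of_bound (hfm.mul hfm).aestronglyMeasurable 1 (ae_of_all _ fun ν => ?_)
    rw [norm_mul]
    exact mul_le_one₀ (hbd ν) (norm_nonneg _) (hbd ν)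
  have i1 : ∫ ν, f ν ∂κ = (μ A).toReal := by
    rw [← h1, integral_toReal hmeas.aemeasurable (ae_of_all _ fun ν => measure_lt_top _ _)]
  have i2 : ∫ ν, f ν * f ν ∂κ = (μ A).toReal * (μ A).toReal := by
    have hm2 : Measurable (fun ν : {ν : Measure Q // IsProbabilityMeasure ν} =>
        ν.1 A * ν.1 A) := hmeas.mul hmeas
    rw [← ENNReal.toReal_mul, ← h2, ← integral_toReal hm2.aemeasurable
      (ae_of_all _ fun ν => ENNReal.mul_lt_top (measure_lt_top _ _) (measure_lt_top _ _))]
    simp [hf, ENNReal.toReal_mul]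
  set c := (μ A).toReal with hc
  have i3 : ∫ ν, (f ν - c) ^ 2 ∂κ = 0 := by
    have : ∀ ν, (f ν - c) ^ 2 = f ν * f ν - (2 * c) * f ν + c * c := fun ν => by ring
    simp_rw [this]
    have hs : Integrable (fun ν => f ν * f ν - (2 * c) * f ν) κ := hffi.sub (hfi.const_mul _)
    rw [integral_add hs (integrable_const _),
      integral_sub hffi (hfi.const_mul _), integral_const_mul, i1, i2]
    simp
    ring
  have hi : Integrable (fun ν => (f ν - c) ^ 2) κ := by
    have : (fun ν => (f ν - c) ^ 2) = fun ν => f ν * f ν - (2 * c) * f ν + c * c := by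
      funext ν; ring
    rw [this]
    exact (hffi.sub (hfi.const_mul _)).add (integrable_const _)
  rw [integral_eq_zero_iff_of_nonneg (fun ν => sq_nonneg _) hi] at i3
  filter_upwards [i3] with ν hν
  have : f ν = c := by
    have := pow_eq_zero_iff (two_ne_zero) |>.1 hν
    linarith
  exact (ENNReal.toReal_eq_toReal_iff' (measure_ne_top _ _) (measure_ne_top _ _)).1 this

/-- **A mixture of product squares determines its components** (Lemma 6.9).
Let `Q` be a standard Borel space, `𝒫(Q)` the space of Borel probability measures on `Q`
with the σ-algebra generated by the evaluation maps, `μ` a probability measure on `Q`,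
and `κ` a probability measure on `𝒫(Q)` such that the `κ`-average of `μ′ × μ′` is
`μ × μ`. Then `κ` is the Dirac measure at `μ`. -/
theorem mixture_of_squares_is_dirac
    {Q : Type*} [MeasurableSpace Q] [StandardBorelSpace Q]
    (μ : Measure Q) (hμ : IsProbabilityMeasure μ)
    (κ : Measure {ν : Measure Q // IsProbabilityMeasure ν}) [IsProbabilityMeasure κ]
    (havg : ∀ E : Set (Q × Q), MeasurableSet E →
      ∫⁻ ν : {ν : Measure Q // IsProbabilityMeasure ν}, (ν.1.prod ν.1) E ∂κ =
        (μ.prod μ) E) :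
    κ = Measure.dirac ⟨μ, hμ⟩ := by
  set C := generateSetAlgebra (MeasurableSpace.countableGeneratingSet Q) with hC
  have hCc : C.Countable :=
    countable_generateSetAlgebra MeasurableSpace.countable_countableGeneratingSet
  have hgen : ‹MeasurableSpace Q› = MeasurableSpace.generateFrom C := by
    rw [hC, generateFrom_generateSetAlgebra_eq,
      MeasurableSpace.generateFrom_countableGeneratingSet]
  have hpi : IsPiSystem C := fun s hs t ht _ =>
    isSetAlgebra_generateSetAlgebra.isSetRing.inter_mem hs ht
  have hCm : ∀ s ∈ C, MeasurableSet s := fun s hs => by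
    rw [hgen]; exact MeasurableSpace.measurableSet_generateFrom hs
  have hae : ∀ᵐ ν ∂κ, ν = ⟨μ, hμ⟩ := by
    have : ∀ᵐ ν ∂κ, ∀ s ∈ C, ν.1 s = μ s :=
      (ae_ball_iff hCc).2 fun s hs => ae_eval_eq μ hμ κ havg s (hCm s hs)
    filter_upwards [this] with ν hν
    have := ν.2
    exact Subtype.ext (ext_of_generate_finite C hgen hpi hν (by simp))
  have h : κ.map id = κ.map (fun _ => ⟨μ, hμ⟩) := Measure.map_congr hae
  rw [Measure.map_id, Measure.map_const] at h
  simpa using h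
end
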